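/- arXiv:1509.08723 — 2 statements merged into one kernel-verified Lean document; each statement's English description precedes it below -/
import Mathlib

section
/- For every x > 0 and every real τ ≠ 0, the integral ∫_0^∞ K_{iτ}(√y)² / (x+y) dy equals (π³ / (2 sinh²(πτ))) · [ Im[J_{iτ}(√x)²]/sinh(πτ) − (1/π)( J_{iτ}(√x) · ∂_ε J_{ε−iτ}(√x)|_{ε=0} + J_{−iτ}(√x) · ∂_ε J_{ε+iτ}(√x)|_{ε=0} ) ]. -/
open Complex MeasureTheory Real Set

/-- Bessel function of the first kind, defined by its power series. -/
noncomputable def besselJ (ν z : ℂ) : ℂ :=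
  ∑' k : ℕ, ((-1 : ℂ) ^ k * (z / 2) ^ (2 * (k : ℂ) + ν)) /
    ((k.factorial : ℂ) * Complex.Gamma ((k : ℂ) + ν + 1))

/-- Modified Bessel function of the first kind, defined by its power series. -/
noncomputable def besselI (ν z : ℂ) : ℂ :=
  ∑' k : ℕ, (z / 2) ^ (2 * (k : ℂ) + ν) /
    ((k.factorial : ℂ) * Complex.Gamma ((k : ℂ) + ν + 1))

/-- The Macdonald function `K_ν(z) = π (I_{−ν}(z) − I_ν(z)) / (2 sin(πν))`. -/
noncomputable def besselK (ν z : ℂ) : ℂ :=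
  (π : ℂ) * (besselI (-ν) z - besselI ν z) / (2 * Complex.sin ((π : ℂ) * ν))

/-- The bracketed kernel of the inversion formula:
`Im[J_{iτ}(√x)²]/sinh(πτ) − (1/π)(J_{iτ}(√x)·∂_ε J_{ε−iτ}(√x)|_{ε=0}
+ J_{−iτ}(√x)·∂_ε J_{ε+iτ}(√x)|_{ε=0})`. -/
noncomputable def invBracket (x τ : ℝ) : ℂ :=
  ((((besselJ (Complex.I * τ) (Real.sqrt x : ℂ)) ^ 2).im / Real.sinh (π * τ) : ℝ) : ℂ) -
    (1 / (π : ℂ)) *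
      (besselJ (Complex.I * τ) (Real.sqrt x : ℂ) *
          deriv (fun ε : ℝ => besselJ ((ε : ℂ) - Complex.I * τ) (Real.sqrt x : ℂ)) 0 +
        besselJ (-(Complex.I * τ)) (Real.sqrt x : ℂ) *
          deriv (fun ε : ℝ => besselJ ((ε : ℂ) + Complex.I * τ) (Real.sqrt x : ℂ)) 0)

open Filter Topology Asymptotics

/-! ### Everywhere convergent series in `exp (2 r)` -/

/-- The power series with coefficients `c` converges on the whole complex plane. -/
def EntireCoeff (c : ℕ → ℂ) : Prop := ∀ w : ℂ, Summable fun k => c k * w ^ k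

/-- The power series with coefficients `c`, evaluated at `exp (2 r)`. -/
noncomputable def expSeries (c : ℕ → ℂ) (r : ℝ) : ℂ := ∑' k, c k * Complex.exp (2 * r) ^ k

lemma EntireCoeff.mul_index {c : ℕ → ℂ} (hc : EntireCoeff c) :
    EntireCoeff fun k => 2 * k * c k := by
  intro w
  refine Summable.of_norm_bounded (g := fun k => 2 * ‖c k * (2 * w) ^ k‖)
    ((hc (2 * w)).norm.mul_left 2) fun k => ?_
  have h : (k : ℝ) ≤ 2 ^ k := by exact_mod_cast Nat.lt_two_pow_self.le
  simp only [norm_mul, norm_pow, Complex.norm_natCast, Complex.norm_ofNat, mul_pow]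
  have : 0 ≤ ‖c k‖ * ‖w‖ ^ k := by positivity
  nlinarith

lemma EntireCoeff.hasDerivAt {c : ℕ → ℂ} (hc : EntireCoeff c) (r : ℝ) :
    HasDerivAt (expSeries c) (expSeries (fun k => 2 * k * c k) r) r := by
  have hu := (hc.mul_index (Complex.exp (2 * (r + 1)))).norm
  refine hasDerivAt_tsum_of_isPreconnected (t := Iio (r + 1)) (y₀ := r) (y := r)
    (g := fun k (y : ℝ) => c k * Complex.exp (2 * y) ^ k)
    (g' := fun k (y : ℝ) => 2 * k * c k * Complex.exp (2 * y) ^ k) hu isOpen_Iio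
    isPreconnected_Iio ?_ ?_ (by simp) (hc _) (by simp)
  · intro k y _
    have h1 : HasDerivAt (fun y : ℝ => Complex.exp (k * (2 * y)))
        (Complex.exp (k * (2 * y)) * (k * (2 * 1))) y :=
      (((Complex.ofRealCLM.hasDerivAt (x := y)).const_mul 2).const_mul (k : ℂ)).cexp
    simp only [← Complex.exp_nat_mul]
    exact (h1.const_mul (c k)).congr_deriv (by ring)
  · intro k y hy
    simp only [norm_mul, norm_pow]
    gcongr
    rw [Complex.norm_exp, Complex.norm_exp]
    have : y < r + 1 := hy
    simp
    linarith

lemma EntireCoeff.continuous {c : ℕ → ℂ} (hc : EntireCoeff c) : Continuous (expSeries c) :=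
  continuous_iff_continuousAt.2 fun r => (hc.hasDerivAt r).continuousAt

/-! ### Limits at `-∞` with exponential rate -/

/-- `f` tends to `l` at `-∞` with error `O(exp r)`. -/
def FastLim (f : ℝ → ℂ) (l : ℂ) : Prop := (fun r => f r - l) =O[atBot] Real.exp

lemma FastLim.const (l : ℂ) : FastLim (fun _ => l) l := by
  simpa [FastLim] using isBigO_zero (E' := ℂ) Real.exp atBot

lemma FastLim.add {f g : ℝ → ℂ} {a b : ℂ} (hf : FastLim f a) (hg : FastLim g b) :
    FastLim (fun r => f r + g r) (a + b) :=
  (IsBigO.add hf hg).congr_left fun r => by ring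

lemma FastLim.sub {f g : ℝ → ℂ} {a b : ℂ} (hf : FastLim f a) (hg : FastLim g b) :
    FastLim (fun r => f r - g r) (a - b) :=
  (IsBigO.sub hf hg).congr_left fun r => by ring

lemma FastLim.const_mul {f : ℝ → ℂ} {a : ℂ} (c : ℂ) (hf : FastLim f a) :
    FastLim (fun r => c * f r) (c * a) :=
  (IsBigO.const_mul_left hf c).congr_left fun r => by ring

lemma FastLim.tendsto_sub {f : ℝ → ℂ} {a : ℂ} (hf : FastLim f a) :
    Tendsto (fun r => f r - a) atBot (𝓝 0) :=
  IsBigO.trans_tendsto hf Real.tendsto_exp_atBot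

lemma FastLim.tendsto {f : ℝ → ℂ} {a : ℂ} (hf : FastLim f a) : Tendsto f atBot (𝓝 a) :=
  tendsto_sub_nhds_zero_iff.1 hf.tendsto_sub

lemma FastLim.mul {f g : ℝ → ℂ} {a b : ℂ} (hf : FastLim f a) (hg : FastLim g b) :
    FastLim (fun r => f r * g r) (a * b) := by
  have h1 : (fun r => (f r - a) * g r) =O[atBot] fun r => Real.exp r * (1 : ℝ) :=
    IsBigO.mul hf (hg.tendsto.isBigO_one ℝ)
  have h2 := IsBigO.const_mul_left hg a
  simp only [mul_one] at h1
  exact (h1.add h2).congr_left fun r => by ring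

lemma FastLim.tendsto_id_mul {f : ℝ → ℂ} {a : ℂ} (hf : FastLim f a) :
    Tendsto (fun r : ℝ => (r : ℂ) * (f r - a)) atBot (𝓝 0) := by
  have h : (fun r : ℝ => (r : ℂ) * (f r - a)) =O[atBot] fun r => r * Real.exp r :=
    IsBigO.mul (IsBigO.of_bound 1 (Eventually.of_forall fun r => by simp)) hf
  refine h.trans_tendsto ?_
  have := (Real.tendsto_pow_mul_exp_neg_atTop_nhds_zero 1).comp tendsto_neg_atBot_atTop
  simpa [Function.comp_def] using this.neg

lemma FastLim.tendsto_exp_mul {f : ℝ → ℂ} {a lam : ℂ} (hf : FastLim f a) (hl : lam.re = 0) :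
    Tendsto (fun r : ℝ => Complex.exp (lam * r) * (f r - a)) atBot (𝓝 0) := by
  rw [tendsto_zero_iff_norm_tendsto_zero]
  simpa [Complex.norm_exp, hl] using hf.tendsto_sub.norm

lemma FastLim.exp_two : FastLim (fun r => Complex.exp (2 * r)) 0 := by
  refine IsBigO.of_bound 1 ?_
  filter_upwards [eventually_le_atBot 0] with r hr
  simp [Complex.norm_exp]
  linarith

lemma EntireCoeff.fastLim {c : ℕ → ℂ} (hc : EntireCoeff c) : FastLim (expSeries c) (c 0) := by
  have hs := ((summable_nat_add_iff 1).2 (hc 1).norm)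
  refine IsBigO.of_bound (∑' k, ‖c (k + 1) * 1 ^ (k + 1)‖) ?_
  filter_upwards [eventually_le_atBot 0] with r hr
  have h1 : expSeries c r - c 0 = ∑' k, c (k + 1) * Complex.exp (2 * r) ^ (k + 1) := by
    rw [expSeries, (hc _).tsum_eq_zero_add]; simp
  rw [h1, Real.norm_of_nonneg (Real.exp_pos r).le, ← tsum_mul_right]
  refine tsum_of_norm_bounded (hs.mul_right _).hasSum fun k => ?_
  have h2 : ‖Complex.exp (2 * r)‖ ≤ Real.exp r := by
    rw [Complex.norm_exp]; simp; linarith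
  have h3 : ‖Complex.exp (2 * r)‖ ≤ 1 := h2.trans (by simpa using hr)
  simp only [norm_mul, norm_pow, one_pow, mul_one, pow_succ]
  gcongr
  calc _ ≤ 1 * Real.exp r := by gcongr; exact pow_le_one₀ (norm_nonneg _) h3
    _ = _ := one_mul _

/-! ### The coefficients of the Bessel series -/

/-- `ε ^ k / (k! Γ(k + μ + 1))`. -/
noncomputable def besselCoeff (ε μ : ℂ) (k : ℕ) : ℂ :=
  ε ^ k * (Complex.Gamma (k + μ + 1))⁻¹ / k.factorial

/-- The derivative of `besselCoeff` in the order. -/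
noncomputable def besselCoeffDeriv (ε μ : ℂ) (k : ℕ) : ℂ :=
  deriv (fun μ => besselCoeff ε μ k) μ

lemma differentiable_besselCoeff (ε : ℂ) (k : ℕ) :
    Differentiable ℂ fun μ => besselCoeff ε μ k := by
  have h : Differentiable ℂ fun μ : ℂ => (Complex.Gamma (k + μ + 1))⁻¹ :=
    Complex.differentiable_one_div_Gamma.comp
      (((differentiable_const _).add differentiable_id).add (differentiable_const _))
  exact (h.const_mul _).div_const _

lemma besselCoeff_succ (ε μ : ℂ) (k : ℕ) :
    (k + 1) * (k + 1 + μ) * besselCoeff ε μ (k + 1) = ε * besselCoeff ε μ k := by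
  have h := Complex.one_div_Gamma_eq_self_mul_one_div_Gamma_add_one (k + μ + 1)
  have hk : (k : ℂ) + 1 ≠ 0 := Nat.cast_add_one_ne_zero k
  have hf : (k.factorial : ℂ) ≠ 0 := by exact_mod_cast k.factorial_ne_zero
  simp only [besselCoeff, h, Nat.factorial_succ, Nat.cast_mul, Nat.cast_add, Nat.cast_one]
  rw [show (k : ℂ) + 1 + μ + 1 = k + μ + 1 + 1 by ring]
  field_simp
  ring

lemma besselCoeffDeriv_succ (ε μ : ℂ) (k : ℕ) :
    (k + 1) * besselCoeff ε μ (k + 1) + (k + 1) * (k + 1 + μ) * besselCoeffDeriv ε μ (k + 1) =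
      ε * besselCoeffDeriv ε μ k := by
  have h1 := (differentiable_besselCoeff ε (k + 1) μ).hasDerivAt
  have h2 := (differentiable_besselCoeff ε k μ).hasDerivAt.const_mul ε
  have h3 : HasDerivAt (fun μ : ℂ => ((k : ℂ) + 1) * (k + 1 + μ)) (k + 1) μ := by
    simpa using ((hasDerivAt_id μ).const_add ((k : ℂ) + 1)).const_mul ((k : ℂ) + 1)
  have h4 := h3.mul h1
  rw [show (fun μ : ℂ => ((k : ℂ) + 1) * (k + 1 + μ)) * (fun μ => besselCoeff ε μ (k + 1)) =
    fun μ => ε * besselCoeff ε μ k from funext fun μ => besselCoeff_succ ε μ k] at h4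
  exact h4.unique h2

lemma besselCoeff_bound {ε ν : ℂ} (hε : ‖ε‖ ≤ 1) (hν : ν.re = 0) :
    ∃ C : ℝ, ∀ k, ∀ μ ∈ Metric.ball ν (1 / 2), ‖besselCoeff ε μ k‖ ≤ C * (2 ^ k / k.factorial) := by
  have hcont : Continuous fun μ : ℂ => (Complex.Gamma (μ + 1))⁻¹ :=
    (Complex.differentiable_one_div_Gamma.comp
      (differentiable_id.add (differentiable_const _))).continuous
  obtain ⟨C, hC⟩ := (isCompact_closedBall ν (1 / 2)).exists_bound_of_continuousOn hcont.continuousOn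
  refine ⟨C, fun k μ hμ => ?_⟩
  have hre : -(1 / 2) ≤ μ.re := by
    have h1 : ‖μ - ν‖ < 1 / 2 := by simpa [dist_eq_norm] using hμ
    have h2 := (abs_le.1 (Complex.abs_re_le_norm (μ - ν))).1
    simp [hν] at h2
    linarith
  have hG : ∀ k : ℕ, ‖(Complex.Gamma (k + μ + 1))⁻¹‖ ≤ C * 2 ^ k := by
    intro k
    induction k with
    | zero => simpa using hC μ (Metric.ball_subset_closedBall hμ)
    | succ k ih =>
      rw [Complex.one_div_Gamma_eq_self_mul_one_div_Gamma_add_one, norm_mul] at ih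
      have h1 : 1 / 2 ≤ ‖(k : ℂ) + μ + 1‖ := by
        refine le_trans ?_ (Complex.re_le_norm _)
        have : (0 : ℝ) ≤ k := k.cast_nonneg
        simp
        linarith
      rw [show ((k + 1 : ℕ) : ℂ) + μ + 1 = k + μ + 1 + 1 by push_cast; ring, pow_succ]
      have h2 := mul_le_mul_of_nonneg_right h1 (norm_nonneg (Complex.Gamma (k + μ + 1 + 1))⁻¹)
      linarith
  rw [besselCoeff, norm_div, norm_mul, norm_pow, Complex.norm_natCast, ← mul_div_assoc]
  refine div_le_div_of_nonneg_right ?_ (Nat.cast_nonneg _)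
  calc _ ≤ 1 * (C * 2 ^ k) :=
        mul_le_mul (pow_le_one₀ (norm_nonneg _) hε) (hG k) (norm_nonneg _) zero_le_one
    _ = _ := one_mul _

lemma summable_bound (C : ℝ) (w : ℂ) :
    Summable fun k : ℕ => C * (2 ^ k / k.factorial) * ‖w‖ ^ k := by
  refine ((Real.summable_pow_div_factorial (2 * ‖w‖)).mul_left C).congr fun k => ?_
  rw [mul_pow]; ring

lemma entireCoeff_besselCoeff {ε ν : ℂ} (hε : ‖ε‖ ≤ 1) (hν : ν.re = 0) :
    EntireCoeff (besselCoeff ε ν) := by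
  obtain ⟨C, hC⟩ := besselCoeff_bound hε hν
  intro w
  refine Summable.of_norm_bounded (summable_bound C w) fun k => ?_
  rw [norm_mul, norm_pow]
  gcongr
  exact hC k ν (Metric.mem_ball_self (by norm_num))

lemma hasSum_besselCoeffDeriv {ε ν : ℂ} (hε : ‖ε‖ ≤ 1) (hν : ν.re = 0) (w : ℂ) :
    HasSum (fun k => besselCoeffDeriv ε ν k * w ^ k)
      (deriv (fun μ => ∑' k, besselCoeff ε μ k * w ^ k) ν) := by
  obtain ⟨C, hC⟩ := besselCoeff_bound hε hν
  have h := Complex.hasSum_deriv_of_summable_norm (U := Metric.ball ν (1 / 2)) (z := ν)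
    (F := fun k μ => besselCoeff ε μ k * w ^ k) (summable_bound C w)
    (fun k => ((differentiable_besselCoeff ε k).mul_const _).differentiableOn) Metric.isOpen_ball
    (fun k μ hμ => by rw [norm_mul, norm_pow]; gcongr; exact hC k μ hμ)
    (Metric.mem_ball_self (by norm_num))
  refine h.congr_fun fun k => ?_
  simp [besselCoeffDeriv]

lemma entireCoeff_besselCoeffDeriv {ε ν : ℂ} (hε : ‖ε‖ ≤ 1) (hν : ν.re = 0) :
    EntireCoeff (besselCoeffDeriv ε ν) := fun w => (hasSum_besselCoeffDeriv hε hν w).summable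

lemma hasDerivAt_expSeries_order {ε ν : ℂ} (hε : ‖ε‖ ≤ 1) (hν : ν.re = 0) (r : ℝ) :
    HasDerivAt (fun μ => expSeries (besselCoeff ε μ) r) (expSeries (besselCoeffDeriv ε ν) r) ν := by
  obtain ⟨C, hC⟩ := besselCoeff_bound hε hν
  have hd : DifferentiableOn ℂ (fun μ => expSeries (besselCoeff ε μ) r) (Metric.ball ν (1 / 2)) :=
    Complex.differentiableOn_tsum_of_summable_norm (summable_bound C (Complex.exp (2 * r)))
      (fun k => ((differentiable_besselCoeff ε k).mul_const _).differentiableOn) Metric.isOpen_ball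
      (fun k μ hμ => by rw [norm_mul, norm_pow]; gcongr; exact hC k μ hμ)
  rw [expSeries, (hasSum_besselCoeffDeriv hε hν _).tsum_eq]
  exact (hd.differentiableAt (Metric.ball_mem_nhds ν (by norm_num))).hasDerivAt

/-- Multiplication by the argument shifts the coefficients of an entire series. -/
lemma expSeries_shift {c d : ℕ → ℂ} {a : ℂ} (hd : EntireCoeff d)
    (h0 : d 0 = 0) (h : ∀ k, d (k + 1) = a * c k) (r : ℝ) :
    expSeries d r = a * Complex.exp (2 * r) * expSeries c r := by
  rw [expSeries, (hd _).tsum_eq_zero_add, h0, expSeries, ← tsum_mul_left]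
  simp only [h, pow_succ, zero_mul, zero_add]
  exact tsum_congr fun k => by ring

lemma expSeries_add_mul {c d : ℕ → ℂ} (hc : EntireCoeff c) (hd : EntireCoeff d) (a : ℂ) (r : ℝ) :
    expSeries (fun k => c k + a * d k) r = expSeries c r + a * expSeries d r := by
  simp only [expSeries, ← tsum_mul_left]
  rw [← (hc _).tsum_add ((hd _).mul_left a)]
  exact tsum_congr fun k => by ring

lemma EntireCoeff.add_mul {c d : ℕ → ℂ} (hc : EntireCoeff c) (hd : EntireCoeff d) (a : ℂ) :
    EntireCoeff fun k => c k + a * d k := fun w =>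
  ((hc w).add ((hd w).mul_left a)).congr fun k => by ring

lemma expSeries_besselCoeff_ode {ε ν : ℂ} (hε : ‖ε‖ ≤ 1) (hν : ν.re = 0) (r : ℝ) :
    expSeries (fun k => 2 * k * (2 * k * besselCoeff ε ν k)) r =
      -(2 * ν) * expSeries (fun k => 2 * k * besselCoeff ε ν k) r +
      4 * ε * Complex.exp (2 * r) * expSeries (besselCoeff ε ν) r := by
  have h0 := entireCoeff_besselCoeff hε hν
  have h1 := h0.mul_index
  have h2 := h1.mul_index
  have := expSeries_shift (c := besselCoeff ε ν) (a := 4 * ε) (h2.add_mul h1 (2 * ν)) (by simp)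
    (fun k => by push_cast; linear_combination 4 * besselCoeff_succ ε ν k) r
  rw [expSeries_add_mul h2 h1] at this
  linear_combination this

lemma expSeries_besselCoeffDeriv_ode {ε ν : ℂ} (hε : ‖ε‖ ≤ 1) (hν : ν.re = 0) (r : ℝ) :
    expSeries (fun k => 2 * k * (2 * k * besselCoeffDeriv ε ν k)) r =
      -(2 * ν) * expSeries (fun k => 2 * k * besselCoeffDeriv ε ν k) r -
      2 * expSeries (fun k => 2 * k * besselCoeff ε ν k) r +
      4 * ε * Complex.exp (2 * r) * expSeries (besselCoeffDeriv ε ν) r := by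
  have h0 := (entireCoeff_besselCoeff hε hν).mul_index
  have hd := entireCoeff_besselCoeffDeriv hε hν
  have h1 := hd.mul_index
  have h2 := h1.mul_index
  have := expSeries_shift (c := besselCoeffDeriv ε ν) (a := 4 * ε) ((h2.add_mul h1 (2 * ν)).add_mul h0 2) (by simp)
    (fun k => by push_cast; linear_combination 4 * besselCoeffDeriv_succ ε ν k) r
  rw [expSeries_add_mul (h2.add_mul h1 _) h0, expSeries_add_mul h2 h1] at this
  linear_combination this

lemma half_two_exp_cpow (r : ℝ) (s : ℂ) :
    (((2 * Real.exp r : ℝ) : ℂ) / 2) ^ s = Complex.exp (s * r) := by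
  have h : ((2 * Real.exp r : ℝ) : ℂ) / 2 = ((Real.exp r : ℝ) : ℂ) := by push_cast; ring
  rw [h, Complex.cpow_def_of_ne_zero (by exact_mod_cast (Real.exp_pos r).ne'),
    ← Complex.ofReal_log (Real.exp_pos r).le, Real.log_exp, mul_comm]

lemma besselJ_eq_expSeries (μ : ℂ) (r : ℝ) :
    besselJ μ ((2 * Real.exp r : ℝ) : ℂ) =
      Complex.exp (μ * r) * expSeries (besselCoeff (-1) μ) r := by
  rw [besselJ, expSeries, ← tsum_mul_left]
  refine tsum_congr fun k => ?_
  rw [half_two_exp_cpow, besselCoeff, add_mul, Complex.exp_add, ← Complex.exp_nat_mul,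
    show 2 * (k : ℂ) * r = k * (2 * r) by ring]
  field_simp

lemma besselI_eq_expSeries (μ : ℂ) (r : ℝ) :
    besselI μ ((2 * Real.exp r : ℝ) : ℂ) =
      Complex.exp (μ * r) * expSeries (besselCoeff 1 μ) r := by
  rw [besselI, expSeries, ← tsum_mul_left]
  refine tsum_congr fun k => ?_
  rw [half_two_exp_cpow, besselCoeff, add_mul, Complex.exp_add, ← Complex.exp_nat_mul,
    show 2 * (k : ℂ) * r = k * (2 * r) by ring]
  simp only [one_pow]
  field_simp

/-! ### Uniqueness for linear systems that are regular at `-∞` -/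

/-- A solution of `‖Y'‖ ≤ C exp (2 r) ‖Y‖` that vanishes at `-∞` is zero. -/
lemma eq_zero_of_norm_deriv_le {E : Type*} [NormedAddCommGroup E] [NormedSpace ℝ E]
    {Y Y' : ℝ → E} {C : ℝ} (hY : ∀ r, HasDerivAt Y (Y' r) r)
    (hC : ∀ r, ‖Y' r‖ ≤ C * Real.exp (2 * r) * ‖Y r‖) (h0 : Tendsto Y atBot (𝓝 0)) (r : ℝ) :
    Y r = 0 := by
  have hZ : ∀ x : ℝ, 0 < x → HasDerivAt (fun x => Y (Real.log x / 2))
      ((x⁻¹ / 2) • Y' (Real.log x / 2)) x := fun x hx =>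
    (hY (Real.log x / 2)).scomp x ((Real.hasDerivAt_log hx.ne').div_const 2)
  have hbound : ∀ x : ℝ, 0 < x → ‖(x⁻¹ / 2) • Y' (Real.log x / 2)‖ ≤
      (C / 2) * ‖Y (Real.log x / 2)‖ + 0 := by
    intro x hx
    have h := hC (Real.log x / 2)
    rw [mul_div_cancel₀ _ (two_ne_zero), Real.exp_log hx] at h
    rw [norm_smul, Real.norm_of_nonneg (by positivity)]
    calc _ ≤ (x⁻¹ / 2) * (C * x * ‖Y (Real.log x / 2)‖) := by gcongr
      _ = _ := by field_simp; ring
  set X := Real.exp (2 * r) with hX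
  have hXpos : 0 < X := Real.exp_pos _
  have hle : ∀ᶠ e in 𝓝[>] (0 : ℝ), ‖Y r‖ ≤ ‖Y (Real.log e / 2)‖ * Real.exp (C / 2 * (X - e)) := by
    filter_upwards [Ioo_mem_nhdsGT hXpos] with e he
    have h := norm_le_gronwallBound_of_norm_deriv_right_le
      (f := fun x => Y (Real.log x / 2)) (a := e) (b := X) (δ := ‖Y (Real.log e / 2)‖)
      (fun x hx => (hZ x (he.1.trans_le hx.1)).continuousAt.continuousWithinAt)
      (fun x hx => (hZ x (he.1.trans_le hx.1)).hasDerivWithinAt) le_rfl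
      (fun x hx => hbound x (he.1.trans_le hx.1)) X ⟨he.2.le, le_rfl⟩
    rw [gronwallBound_ε0] at h
    simpa [hX] using h
  have hlog : Tendsto (fun e : ℝ => Real.log e / 2) (𝓝[>] 0) atBot :=
    Real.tendsto_log_nhdsGT_zero.atBot_div_const two_pos
  have hlim : Tendsto (fun e : ℝ => ‖Y (Real.log e / 2)‖ * Real.exp (C / 2 * (X - e)))
      (𝓝[>] 0) (𝓝 (‖(0 : E)‖ * Real.exp (C / 2 * (X - 0)))) := by
    refine (h0.comp hlog).norm.mul (Tendsto.mono_left ?_ nhdsWithin_le_nhds)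
    exact Continuous.tendsto (by fun_prop) 0
  rw [norm_zero, zero_mul] at hlim
  exact norm_le_zero_iff.1 (ge_of_tendsto hlim hle)

lemma norm_cexp_mul_ofReal {lam : ℂ} (h : lam.re = 0) (r : ℝ) : ‖Complex.exp (lam * r)‖ = 1 := by
  simp [Complex.norm_exp, h]

lemma hasDerivAt_cexp_mul (lam : ℂ) (r : ℝ) :
    HasDerivAt (fun r : ℝ => Complex.exp (lam * r)) (lam * Complex.exp (lam * r)) r := by
  have h := ((Complex.ofRealCLM.hasDerivAt (x := r)).const_mul lam).cexp
  exact h.congr_deriv (by simp; ring)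

/-- Uniqueness for `d'' = (ν² + 4 exp (2 r)) d` with imaginary `ν ≠ 0`. -/
lemma second_order_eq_zero {ν : ℂ} (hre : ν.re = 0) (hν : ν ≠ 0) {d d1 : ℝ → ℂ}
    (h0 : ∀ r, HasDerivAt d (d1 r) r)
    (h1 : ∀ r : ℝ, HasDerivAt d1 ((ν ^ 2 + 4 * Complex.exp (2 * r)) * d r) r)
    (l0 : Tendsto d atBot (𝓝 0)) (l1 : Tendsto d1 atBot (𝓝 0)) (r : ℝ) : d r = 0 := by
  have hre' : (-ν).re = 0 := by simp [hre]
  have hνn : 0 < ‖ν‖ := norm_pos_iff.2 hν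
  let Y : ℝ → ℂ × ℂ := fun r =>
    (Complex.exp (ν * r) * (d1 r - ν * d r), Complex.exp (-ν * r) * (d1 r + ν * d r))
  have hY : ∀ r : ℝ, HasDerivAt Y (Complex.exp (ν * r) * (4 * Complex.exp (2 * r) * d r),
      Complex.exp (-ν * r) * (4 * Complex.exp (2 * r) * d r)) r := by
    intro r
    refine HasDerivAt.prodMk ?_ ?_
    · exact ((hasDerivAt_cexp_mul ν r).mul ((h1 r).sub ((h0 r).const_mul ν))).congr_deriv
        (by simp only [Pi.sub_apply]; ring)
    · exact ((hasDerivAt_cexp_mul (-ν) r).mul ((h1 r).add ((h0 r).const_mul ν))).congr_deriv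
        (by simp only [Pi.add_apply]; ring)
  have hd : ∀ r, ‖d r‖ ≤ ‖Y r‖ / ‖ν‖ := by
    intro r
    have e : 2 * ν * d r = (d1 r + ν * d r) - (d1 r - ν * d r) := by ring
    have h2 : 2 * ‖ν‖ * ‖d r‖ ≤ ‖Y r‖ + ‖Y r‖ := by
      calc _ = ‖2 * ν * d r‖ := by simp
        _ ≤ ‖d1 r + ν * d r‖ + ‖d1 r - ν * d r‖ := by rw [e]; exact norm_sub_le _ _
        _ = ‖(Y r).2‖ + ‖(Y r).1‖ := by
          simp only [Y, norm_mul, norm_cexp_mul_ofReal hre, norm_cexp_mul_ofReal hre', one_mul]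
        _ ≤ _ := add_le_add (norm_snd_le _) (norm_fst_le _)
    rw [le_div_iff₀ hνn]
    linarith
  have hY0 : Tendsto Y atBot (𝓝 0) := by
    have key : ∀ {lam : ℂ} {f : ℝ → ℂ}, lam.re = 0 → Tendsto f atBot (𝓝 0) →
        Tendsto (fun r : ℝ => Complex.exp (lam * r) * f r) atBot (𝓝 0) := by
      intro lam f hl hf
      rw [tendsto_zero_iff_norm_tendsto_zero] at hf ⊢
      simpa only [norm_mul, norm_cexp_mul_ofReal hl, one_mul] using hf
    have e1 : Tendsto (fun r => d1 r - ν * d r) atBot (𝓝 0) := by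
      simpa using l1.sub (l0.const_mul ν)
    have e2 : Tendsto (fun r => d1 r + ν * d r) atBot (𝓝 0) := by
      simpa using l1.add (l0.const_mul ν)
    exact (key hre e1).prodMk_nhds (key hre' e2)
  have hg : ∀ r : ℝ, ‖4 * Complex.exp (2 * r) * d r‖ ≤ 4 / ‖ν‖ * Real.exp (2 * r) * ‖Y r‖ := by
    intro r
    have h2 : ‖Complex.exp (2 * r)‖ = Real.exp (2 * r) := by simp [Complex.norm_exp]
    simp only [norm_mul, h2, Complex.norm_ofNat]
    calc _ ≤ 4 * Real.exp (2 * r) * (‖Y r‖ / ‖ν‖) := by gcongr; exact hd r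
      _ = _ := by ring
  have hYz := eq_zero_of_norm_deriv_le hY (fun r => by
    rw [Prod.norm_mk, norm_mul, norm_mul _ (4 * _ * _), norm_cexp_mul_ofReal hre,
      norm_cexp_mul_ofReal hre', one_mul, max_self]
    exact hg r) hY0 r
  have := hd r
  rw [hYz, norm_zero, zero_div] at this
  exact norm_le_zero_iff.1 this

/-- Uniqueness for `d''' - 4 ν² d' + 16 exp (2 r) (d' + d) = 0` with imaginary `ν ≠ 0`. -/
lemma third_order_eq_zero {ν : ℂ} (hre : ν.re = 0) (hν : ν ≠ 0) {d d1 d2 : ℝ → ℂ}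
    (h0 : ∀ r, HasDerivAt d (d1 r) r) (h1 : ∀ r, HasDerivAt d1 (d2 r) r)
    (h2 : ∀ r, HasDerivAt d2 (4 * ν ^ 2 * d1 r - 16 * Complex.exp (2 * r) * (d1 r + d r)) r)
    (l0 : Tendsto d atBot (𝓝 0)) (l1 : Tendsto d1 atBot (𝓝 0)) (l2 : Tendsto d2 atBot (𝓝 0))
    (r : ℝ) : d r = 0 := by
  have hre1 : (2 * ν).re = 0 := by simp [hre]
  have hre2 : (-(2 * ν)).re = 0 := by simp [hre]
  have hνn : 0 < ‖ν‖ := norm_pos_iff.2 hν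
  let g : ℝ → ℂ := fun r => 16 * Complex.exp (2 * r) * (d1 r + d r)
  let Y : ℝ → ℂ × ℂ × ℂ := fun r => (d2 r - 4 * ν ^ 2 * d r,
    Complex.exp (2 * ν * r) * (d2 r - 2 * ν * d1 r),
    Complex.exp (-(2 * ν) * r) * (d2 r + 2 * ν * d1 r))
  have hY : ∀ r, HasDerivAt Y (-g r, -(Complex.exp (2 * ν * r) * g r),
      -(Complex.exp (-(2 * ν) * r) * g r)) r := by
    intro r
    refine HasDerivAt.prodMk ?_ (HasDerivAt.prodMk ?_ ?_)
    · exact ((h2 r).sub ((h0 r).const_mul (4 * ν ^ 2))).congr_deriv (by simp only [g]; ring)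
    · exact ((hasDerivAt_cexp_mul (2 * ν) r).mul
        ((h2 r).sub ((h1 r).const_mul (2 * ν)))).congr_deriv (by simp only [g, Pi.sub_apply]; ring)
    · exact ((hasDerivAt_cexp_mul (-(2 * ν)) r).mul
        ((h2 r).add ((h1 r).const_mul (2 * ν)))).congr_deriv (by simp only [g, Pi.add_apply]; ring)
  have n1 : ∀ r, ‖d2 r - 4 * ν ^ 2 * d r‖ ≤ ‖Y r‖ := fun r => norm_fst_le (Y r)
  have n2 : ∀ r, ‖d2 r - 2 * ν * d1 r‖ ≤ ‖Y r‖ := fun r => by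
    refine le_trans (le_of_eq ?_) ((norm_fst_le (Y r).2).trans (norm_snd_le (Y r)))
    simp only [Y, norm_mul, norm_cexp_mul_ofReal hre1, one_mul]
  have n3 : ∀ r, ‖d2 r + 2 * ν * d1 r‖ ≤ ‖Y r‖ := fun r => by
    refine le_trans (le_of_eq ?_) ((norm_snd_le (Y r).2).trans (norm_snd_le (Y r)))
    simp only [Y, norm_mul, norm_cexp_mul_ofReal hre2, one_mul]
  have hd1 : ∀ r, ‖d1 r‖ ≤ 1 / ‖ν‖ * ‖Y r‖ := by
    intro r
    have e : 4 * ν * d1 r = (d2 r + 2 * ν * d1 r) - (d2 r - 2 * ν * d1 r) := by ring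
    have h : 4 * ‖ν‖ * ‖d1 r‖ ≤ ‖Y r‖ + ‖Y r‖ := by
      calc _ = ‖4 * ν * d1 r‖ := by simp
        _ ≤ _ := by rw [e]; exact (norm_sub_le _ _).trans (add_le_add (n3 r) (n2 r))
    rw [one_div, inv_mul_eq_div, le_div_iff₀ hνn]
    nlinarith [norm_nonneg (Y r)]
  have hd : ∀ r, ‖d r‖ ≤ 1 / ‖ν‖ ^ 2 * ‖Y r‖ := by
    intro r
    have e : 8 * ν ^ 2 * d r = (d2 r + 2 * ν * d1 r) + (d2 r - 2 * ν * d1 r) -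
      2 * (d2 r - 4 * ν ^ 2 * d r) := by ring
    have h : 8 * ‖ν‖ ^ 2 * ‖d r‖ ≤ ‖Y r‖ + ‖Y r‖ + 2 * ‖Y r‖ := by
      calc _ = ‖8 * ν ^ 2 * d r‖ := by simp
        _ ≤ _ := by
          rw [e]
          refine (norm_sub_le _ _).trans (add_le_add ((norm_add_le _ _).trans
            (add_le_add (n3 r) (n2 r))) ?_)
          rw [norm_mul, Complex.norm_ofNat]
          gcongr
          exact n1 r
    rw [one_div, inv_mul_eq_div, le_div_iff₀ (by positivity)]
    nlinarith [norm_nonneg (Y r)]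
  have hY0 : Tendsto Y atBot (𝓝 0) := by
    have key : ∀ {lam : ℂ} {f : ℝ → ℂ}, lam.re = 0 → Tendsto f atBot (𝓝 0) →
        Tendsto (fun r : ℝ => Complex.exp (lam * r) * f r) atBot (𝓝 0) := by
      intro lam f hl hf
      rw [tendsto_zero_iff_norm_tendsto_zero] at hf ⊢
      simpa only [norm_mul, norm_cexp_mul_ofReal hl, one_mul] using hf
    have e0 : Tendsto (fun r => d2 r - 4 * ν ^ 2 * d r) atBot (𝓝 0) := by
      simpa using l2.sub (l0.const_mul (4 * ν ^ 2))
    have e1 : Tendsto (fun r => d2 r - 2 * ν * d1 r) atBot (𝓝 0) := by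
      simpa using l2.sub (l1.const_mul (2 * ν))
    have e2 : Tendsto (fun r => d2 r + 2 * ν * d1 r) atBot (𝓝 0) := by
      simpa using l2.add (l1.const_mul (2 * ν))
    exact e0.prodMk_nhds ((key hre1 e1).prodMk_nhds (key hre2 e2))
  have hg : ∀ r, ‖g r‖ ≤ 16 * (1 / ‖ν‖ + 1 / ‖ν‖ ^ 2) * Real.exp (2 * r) * ‖Y r‖ := by
    intro r
    have h : ‖Complex.exp (2 * r)‖ = Real.exp (2 * r) := by simp [Complex.norm_exp]
    simp only [g, norm_mul, h, Complex.norm_ofNat]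
    calc _ ≤ 16 * Real.exp (2 * r) * (1 / ‖ν‖ * ‖Y r‖ + 1 / ‖ν‖ ^ 2 * ‖Y r‖) := by
          gcongr
          exact (norm_add_le _ _).trans (add_le_add (hd1 r) (hd r))
      _ = _ := by ring
  have hYz := eq_zero_of_norm_deriv_le hY (fun r => by
    simp only [Prod.norm_mk, norm_neg, norm_mul, norm_cexp_mul_ofReal hre1,
      norm_cexp_mul_ofReal hre2, one_mul, max_self]
    exact hg r) hY0 r
  have := hd r
  rw [hYz, norm_zero, mul_zero] at this
  exact norm_le_zero_iff.1 this

/-! ### The integrals `∫ s ^ j exp (μ s) exp (-exp s - exp (2 r - s)) ds` -/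

lemma integrable_exp_neg_mul_abs {b : ℝ} (hb : 0 < b) :
    Integrable fun s : ℝ => Real.exp (-b * |s|) := by
  rw [← integrableOn_univ, ← Iic_union_Ioi (a := (0 : ℝ))]
  refine IntegrableOn.union ?_ ?_
  · refine (integrableOn_exp_mul_Iic hb 0).congr_fun (fun s hs => ?_) measurableSet_Iic
    simp only [abs_of_nonpos (show s ≤ 0 from hs), neg_mul_neg]
  · refine (integrableOn_exp_mul_Ioi (neg_lt_zero.2 hb) 0).congr_fun (fun s hs => ?_)
      measurableSet_Ioi
    simp only [abs_of_pos (show 0 < s from hs)]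

lemma abs_pow_le_exp {j : ℕ} (hj : j ≤ 1) (s : ℝ) : |s| ^ j ≤ 4 * Real.exp (|s| / 4) := by
  have h := Real.add_one_le_exp (|s| / 4)
  have h0 := abs_nonneg s
  interval_cases j
  · simp; linarith
  · simp; linarith

lemma integrable_of_norm_le_exp {f : ℝ → ℂ} (hf : Continuous f) {b C : ℝ} (hb : 0 < b)
    (h : ∀ s, ‖f s‖ ≤ C * Real.exp (-b * |s|)) : Integrable f :=
  ((integrable_exp_neg_mul_abs hb).const_mul C).mono' hf.aestronglyMeasurable (.of_forall h)

lemma tendsto_zero_of_norm_le_exp {f : ℝ → ℂ} {b C : ℝ} (hb : 0 < b)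
    (h : ∀ s, ‖f s‖ ≤ C * Real.exp (-b * |s|)) {l : Filter ℝ} (hl : Tendsto (|·|) l atTop) :
    Tendsto f l (𝓝 0) := by
  refine squeeze_zero_norm h ?_
  have h1 : Tendsto (fun s : ℝ => -b * |s|) l atBot := by
    simpa using hl.const_mul_atTop_of_neg (neg_lt_zero.2 hb)
  simpa using (Real.tendsto_exp_atBot.comp h1).const_mul C

/-- The integrand of `macInt`. -/
noncomputable def macKer (j : ℕ) (μ : ℂ) (r s : ℝ) : ℂ :=
  (s : ℂ) ^ j * Complex.exp (μ * s) * (Real.exp (-(Real.exp s + Real.exp (2 * r - s))) : ℝ)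

/-- The integral `∫ s ^ j exp (μ s) exp (-exp s - exp (2 r - s)) ds`. -/
noncomputable def macInt (j : ℕ) (μ : ℂ) (r : ℝ) : ℂ := ∫ s, macKer j μ r s

lemma continuous_macKer (j : ℕ) (μ : ℂ) (r : ℝ) : Continuous (macKer j μ r) := by
  unfold macKer
  fun_prop

lemma two_mul_exp_le (r s : ℝ) : 2 * Real.exp r ≤ Real.exp s + Real.exp (2 * r - s) := by
  have h1 : Real.exp s = Real.exp (s / 2) ^ 2 := by rw [← Real.exp_nat_mul]; congr 1; push_cast; ring
  have h2 : Real.exp (2 * r - s) = Real.exp (r - s / 2) ^ 2 := by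
    rw [← Real.exp_nat_mul]; congr 1; push_cast; ring
  have h3 : Real.exp r = Real.exp (s / 2) * Real.exp (r - s / 2) := by
    rw [← Real.exp_add]; congr 1; ring
  rw [h1, h2, h3]
  nlinarith [sq_nonneg (Real.exp (s / 2) - Real.exp (r - s / 2))]

lemma min_mul_exp_le {r₀ r : ℝ} (hr : r₀ ≤ r) (s : ℝ) :
    min 1 (Real.exp (2 * r₀)) * Real.exp |s| ≤ Real.exp s + Real.exp (2 * r - s) := by
  have h1 := Real.exp_pos s
  have h2 := Real.exp_pos (2 * r - s)
  rcases le_total 0 s with h | h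
  · rw [abs_of_nonneg h]
    nlinarith [min_le_left 1 (Real.exp (2 * r₀))]
  · rw [abs_of_nonpos h]
    have h3 : Real.exp (2 * r₀) * Real.exp (-s) ≤ Real.exp (2 * r - s) := by
      rw [← Real.exp_add]; gcongr; linarith
    nlinarith [min_le_right 1 (Real.exp (2 * r₀)), Real.exp_pos (-s)]

/-- A uniform bound for the integrand on half lines of `r`. -/
lemma norm_macKer_le (r₀ : ℝ) : ∃ C, 0 ≤ C ∧ ∀ (j : ℕ) (μ : ℂ) (r s : ℝ), j ≤ 1 → |μ.re| ≤ 1 →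
    r₀ ≤ r → ‖macKer j μ r s‖ ≤ C * Real.exp (-Real.exp r) * Real.exp (-1 * |s|) := by
  set c := min 1 (Real.exp (2 * r₀)) with hc
  have hcpos : 0 < c := lt_min one_pos (Real.exp_pos _)
  refine ⟨4 * (24 / (c / 2) ^ 4), by positivity, fun j μ r s hj hμ hr => ?_⟩
  have h1 : ‖macKer j μ r s‖ = |s| ^ j * Real.exp (μ.re * s) *
      Real.exp (-(Real.exp s + Real.exp (2 * r - s))) := by
    rw [macKer, norm_mul, norm_mul, norm_pow, Complex.norm_exp, Complex.norm_real,
      Complex.norm_real, Real.norm_eq_abs, Real.norm_of_nonneg (Real.exp_pos _).le]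
    simp
  have h2 : Real.exp (μ.re * s) ≤ Real.exp |s| := by
    gcongr
    calc μ.re * s ≤ |μ.re| * |s| := by rw [← abs_mul]; exact le_abs_self _
      _ ≤ 1 * |s| := by gcongr
      _ = |s| := one_mul _
  have h3 : |s| ^ j ≤ 4 * Real.exp |s| :=
    (abs_pow_le_exp hj s).trans (by gcongr; linarith [abs_nonneg s])
  have h4 : Real.exp (-(Real.exp s + Real.exp (2 * r - s))) ≤
      Real.exp (-Real.exp r) * Real.exp (-(c / 2 * Real.exp |s|)) := by
    rw [← Real.exp_add]
    gcongr
    linarith [two_mul_exp_le r s, min_mul_exp_le hr s]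
  have h5 : Real.exp (-(c / 2 * Real.exp |s|)) ≤ 24 / (c / 2) ^ 4 * Real.exp (-4 * |s|) := by
    have h := Real.pow_div_factorial_le_exp (c / 2 * Real.exp |s|) (by positivity) 4
    rw [Real.exp_neg, show -4 * |s| = -((4 : ℕ) * |s|) by push_cast; ring, Real.exp_neg,
      Real.exp_nat_mul]
    refine (inv_anti₀ (by positivity) h).trans (le_of_eq ?_)
    simp [Nat.factorial]
    field_simp
  have h6 : Real.exp |s| * Real.exp |s| * Real.exp (-4 * |s|) ≤ Real.exp (-1 * |s|) := by
    rw [← Real.exp_add, ← Real.exp_add]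
    gcongr
    linarith [abs_nonneg s]
  rw [h1]
  calc _ ≤ (4 * Real.exp |s|) * Real.exp |s| *
        (Real.exp (-Real.exp r) * (24 / (c / 2) ^ 4 * Real.exp (-4 * |s|))) := by
        gcongr
        exact h4.trans (by gcongr)
    _ = 4 * (24 / (c / 2) ^ 4) * Real.exp (-Real.exp r) *
        (Real.exp |s| * Real.exp |s| * Real.exp (-4 * |s|)) := by ring
    _ ≤ _ := by gcongr

lemma integrable_macKer {j : ℕ} {μ : ℂ} (hj : j ≤ 1) (hμ : |μ.re| ≤ 1) (r : ℝ) :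
    Integrable (macKer j μ r) := by
  obtain ⟨C, -, hC⟩ := norm_macKer_le r
  exact integrable_of_norm_le_exp (continuous_macKer j μ r) one_pos
    fun s => hC j μ r s hj hμ le_rfl

lemma tendsto_macKer {j : ℕ} {μ : ℂ} (hj : j ≤ 1) (hμ : |μ.re| ≤ 1) (r : ℝ) {l : Filter ℝ}
    (hl : Tendsto (|·|) l atTop) : Tendsto (macKer j μ r) l (𝓝 0) := by
  obtain ⟨C, -, hC⟩ := norm_macKer_le r
  exact tendsto_zero_of_norm_le_exp one_pos (fun s => hC j μ r s hj hμ le_rfl) hl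

lemma norm_macInt_le {j : ℕ} {μ : ℂ} (hj : j ≤ 1) (hμ : |μ.re| ≤ 1) :
    ∃ C, 0 ≤ C ∧ ∀ r : ℝ, 0 ≤ r → ‖macInt j μ r‖ ≤ C * Real.exp (-Real.exp r) := by
  obtain ⟨C, hC0, hC⟩ := norm_macKer_le 0
  refine ⟨C * ∫ s, Real.exp (-1 * |s|), mul_nonneg hC0 (integral_nonneg fun s => (Real.exp_pos _).le),
    fun r hr => ?_⟩
  calc ‖macInt j μ r‖ ≤ ∫ s, C * Real.exp (-Real.exp r) * Real.exp (-1 * |s|) :=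
        norm_integral_le_of_norm_le ((integrable_exp_neg_mul_abs one_pos).const_mul _)
          (.of_forall fun s => hC j μ r s hj hμ hr)
    _ = _ := by rw [integral_const_mul]; ring

lemma macKer_sub_one (j : ℕ) (μ : ℂ) (r s : ℝ) :
    macKer j (μ - 1) r s = Complex.exp (-s) * macKer j μ r s := by
  simp only [macKer, sub_mul, one_mul, sub_eq_add_neg (μ * s), Complex.exp_add]
  ring

lemma macKer_add_one (j : ℕ) (μ : ℂ) (r s : ℝ) :
    macKer j (μ + 1) r s = Complex.exp s * macKer j μ r s := by
  simp only [macKer, add_mul, one_mul, Complex.exp_add]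
  ring

lemma ofReal_exp_two_mul_sub (r s : ℝ) :
    ((Real.exp (2 * r - s) : ℝ) : ℂ) = Complex.exp (2 * r) * Complex.exp (-s) := by
  rw [← Complex.exp_add]
  push_cast
  rfl

lemma hasDerivAt_macInt {j : ℕ} {μ : ℂ} (hj : j ≤ 1) (hμ : |μ.re| ≤ 1) (hμ' : |(μ - 1).re| ≤ 1)
    (r : ℝ) : HasDerivAt (macInt j μ) (-2 * Complex.exp (2 * r) * macInt j (μ - 1) r) r := by
  obtain ⟨C, hC0, hC⟩ := norm_macKer_le (r - 1)
  have h := hasDerivAt_integral_of_dominated_loc_of_deriv_le (μ := volume) (x₀ := r)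
    (s := Ioo (r - 1) (r + 1)) (F := macKer j μ)
    (F' := fun r s => -2 * Complex.exp (2 * r) * macKer j (μ - 1) r s)
    (bound := fun s => 2 * Real.exp (2 * (r + 1)) * (C * Real.exp (-1 * |s|)))
    (Ioo_mem_nhds (by linarith) (by linarith))
    (.of_forall fun r => (continuous_macKer j μ r).aestronglyMeasurable)
    (integrable_macKer hj hμ r)
    (((continuous_macKer j (μ - 1) r).const_mul _).aestronglyMeasurable)
    (.of_forall fun s x hx => ?_)
    (((integrable_exp_neg_mul_abs one_pos).const_mul C).const_mul _)
    (.of_forall fun s x hx => ?_)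
  · exact h.2.congr_deriv (by rw [integral_const_mul]; rfl)
  · rw [norm_mul, norm_mul, Complex.norm_exp, norm_neg, Complex.norm_ofNat]
    have h1 : (2 * (x : ℂ)).re ≤ 2 * (r + 1) := by simp; linarith [hx.2]
    have h2 := hC j (μ - 1) x s hj hμ' hx.1.le
    have h3 : Real.exp (-Real.exp x) ≤ 1 := by simp [Real.exp_nonneg]
    calc _ ≤ 2 * Real.exp (2 * (r + 1)) * (C * Real.exp (-Real.exp x) * Real.exp (-1 * |s|)) := by
          gcongr
      _ ≤ 2 * Real.exp (2 * (r + 1)) * (C * 1 * Real.exp (-1 * |s|)) := by gcongr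
      _ = _ := by rw [mul_one]
  · have h1 : HasDerivAt (fun x : ℝ => Real.exp (-(Real.exp s + Real.exp (2 * x - s))))
        (Real.exp (-(Real.exp s + Real.exp (2 * x - s))) * -(Real.exp (2 * x - s) * (2 * 1))) x :=
      (((((hasDerivAt_id x).const_mul 2).sub_const s).exp.const_add _).neg).exp
    have h2 := h1.ofReal_comp.const_mul ((s : ℂ) ^ j * Complex.exp (μ * s))
    refine h2.congr_deriv ?_
    rw [macKer_sub_one, macKer]
    simp only [Complex.ofReal_mul, Complex.ofReal_neg, ofReal_exp_two_mul_sub]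
    push_cast
    ring

lemma macInt_parts {j : ℕ} {μ : ℂ} (hj : j ≤ 1) (hμ : μ.re = 0) (r : ℝ) :
    j * macInt (j - 1) μ r + μ * macInt j μ r =
      macInt j (1 + μ) r - Complex.exp (2 * r) * macInt j (μ - 1) r := by
  have e0 : |μ.re| ≤ 1 := by simp [hμ]
  have e1 : |(1 + μ).re| ≤ 1 := by simp [hμ]
  have e2 : |(μ - 1).re| ≤ 1 := by simp [hμ]
  have i1 := (integrable_macKer (show j - 1 ≤ 1 by omega) e0 r).const_mul (j : ℂ)
  have i2 := (integrable_macKer hj e0 r).const_mul μ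
  have i3 := integrable_macKer hj e1 r
  have i4 := (integrable_macKer hj e2 r).const_mul (Complex.exp (2 * r))
  have hd : ∀ s : ℝ, HasDerivAt (macKer j μ r) (j * macKer (j - 1) μ r s + μ * macKer j μ r s -
      (macKer j (1 + μ) r s - Complex.exp (2 * r) * macKer j (μ - 1) r s)) s := by
    intro s
    have h1 : HasDerivAt (fun s : ℝ => Real.exp (-(Real.exp s + Real.exp (2 * r - s))))
        (Real.exp (-(Real.exp s + Real.exp (2 * r - s))) *
          -(Real.exp s + Real.exp (2 * r - s) * -1)) s :=
      ((Real.hasDerivAt_exp s).add ((hasDerivAt_id s).const_sub (2 * r)).exp).neg.exp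
    have h2 := ((((Complex.ofRealCLM.hasDerivAt (x := s)).pow j).mul
      (hasDerivAt_cexp_mul μ s)).mul h1.ofReal_comp)
    refine h2.congr_deriv ?_
    rw [macKer_sub_one, add_comm 1 μ, macKer_add_one, macKer, macKer]
    simp only [Pi.mul_apply, Pi.pow_apply, Complex.ofRealCLM_apply, Complex.ofReal_mul,
      Complex.ofReal_neg, Complex.ofReal_add, Complex.ofReal_one, ofReal_exp_two_mul_sub,
      Complex.ofReal_exp s]
    ring
  have h := integral_of_hasDerivAt_of_tendsto hd ((i1.add i2).sub (i3.sub i4))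
    (tendsto_macKer hj e0 r tendsto_abs_atBot_atTop) (tendsto_macKer hj e0 r tendsto_abs_atTop_atTop)
  rw [integral_sub (f := fun s => j * macKer (j - 1) μ r s + μ * macKer j μ r s)
    (g := fun s => macKer j (1 + μ) r s - Complex.exp (2 * r) * macKer j (μ - 1) r s)
    (i1.add i2) (i3.sub i4), integral_add i1 i2, integral_sub i3 i4, integral_const_mul,
    integral_const_mul, integral_const_mul, sub_zero, sub_eq_zero] at h
  exact h

lemma macInt_zero_neg (μ : ℂ) (r : ℝ) :
    macInt 0 (-μ) r = Complex.exp (-2 * μ * r) * macInt 0 μ r := by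
  rw [macInt, ← integral_sub_left_eq_self _ volume (2 * r), macInt, ← integral_const_mul]
  congr 1 with s
  simp only [macKer, pow_zero, one_mul, sub_sub_cancel]
  rw [← mul_assoc, ← Complex.exp_add, add_comm (Real.exp (2 * r - s))]
  push_cast
  congr 2
  ring

lemma macInt_one_neg {μ : ℂ} (hμ : |μ.re| ≤ 1) (r : ℝ) :
    macInt 1 (-μ) r = Complex.exp (-2 * μ * r) * (2 * r * macInt 0 μ r - macInt 1 μ r) := by
  rw [macInt, ← integral_sub_left_eq_self _ volume (2 * r), macInt, macInt, ← integral_const_mul,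
    ← integral_sub ((integrable_macKer zero_le_one hμ r).const_mul _)
      (integrable_macKer le_rfl hμ r), ← integral_const_mul]
  congr 1 with s
  simp only [macKer, pow_zero, pow_one, one_mul, sub_sub_cancel]
  rw [add_comm (Real.exp (2 * r - s)),
    show -μ * ((2 * r - s : ℝ) : ℂ) = -2 * μ * r + μ * s by push_cast; ring, Complex.exp_add]
  push_cast
  ring

/-! ### The limits of the integrals at `-∞` -/

/-- The integral `∫ s ^ j exp (μ s) exp (-exp s) ds`, a derivative of the Gamma function. -/
noncomputable def gammaLog (j : ℕ) (μ : ℂ) : ℂ :=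
  ∫ s : ℝ, (s : ℂ) ^ j * Complex.exp (μ * s) * (Real.exp (-Real.exp s) : ℝ)

lemma exp_half_mul_exp_neg_exp_le (s : ℝ) :
    Real.exp (s / 2) * Real.exp (-Real.exp s) ≤ Real.exp (-(1 / 2) * |s|) := by
  rw [← Real.exp_add]
  gcongr
  rcases le_total 0 s with h | h
  · rw [abs_of_nonneg h]; linarith [Real.add_one_le_exp s]
  · rw [abs_of_nonpos h]; linarith [Real.exp_pos s]

lemma norm_gammaLog_integrand {μ : ℂ} (hμ : μ.re = 1) (j : ℕ) (s : ℝ) :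
    ‖(s : ℂ) ^ j * Complex.exp (μ * s) * (Real.exp (-Real.exp s) : ℝ)‖ =
      |s| ^ j * Real.exp s * Real.exp (-Real.exp s) := by
  rw [norm_mul, norm_mul, norm_pow, Complex.norm_exp, Complex.norm_real,
    Complex.norm_real, Real.norm_eq_abs, Real.norm_of_nonneg (Real.exp_pos _).le]
  simp [hμ]

lemma integrable_gammaLog {j : ℕ} {μ : ℂ} (hj : j ≤ 1) (hμ : μ.re = 1) : Integrable fun s : ℝ =>
    (s : ℂ) ^ j * Complex.exp (μ * s) * (Real.exp (-Real.exp s) : ℝ) := by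
  refine integrable_of_norm_le_exp (b := 3 / 4) (C := 8) (by fun_prop) (by norm_num) fun s => ?_
  rw [norm_gammaLog_integrand hμ]
  have h1 : Real.exp s * Real.exp (-Real.exp s) ≤ 2 * Real.exp (-|s|) := by
    rcases le_total 0 s with h | h
    · rw [abs_of_nonneg h, Real.exp_neg, Real.exp_neg]
      have := Real.pow_div_factorial_le_exp (Real.exp s) (Real.exp_pos s).le 2
      have h2 := Real.exp_pos s
      have h3 := Real.exp_pos (Real.exp s)
      rw [← div_eq_mul_inv, ← div_eq_mul_inv, div_le_div_iff₀ h3 h2]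
      simp [Nat.factorial] at this
      linarith
    · rw [abs_of_nonpos h, neg_neg]
      have : Real.exp (-Real.exp s) ≤ 1 := by simp [Real.exp_nonneg]
      nlinarith [Real.exp_pos s]
  calc |s| ^ j * Real.exp s * Real.exp (-Real.exp s)
      = |s| ^ j * (Real.exp s * Real.exp (-Real.exp s)) := by ring
    _ ≤ (4 * Real.exp (|s| / 4)) * (2 * Real.exp (-|s|)) := by
        gcongr
        exact abs_pow_le_exp hj s
    _ = 8 * (Real.exp (|s| / 4) * Real.exp (-|s|)) := by ring
    _ = _ := by rw [← Real.exp_add]; congr 2; ring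

lemma one_sub_exp_neg_sq_le {x : ℝ} (hx : 0 ≤ x) : 1 - Real.exp (-x ^ 2) ≤ x := by
  rcases le_total x 1 with h | h
  · nlinarith [Real.add_one_le_exp (-x ^ 2)]
  · linarith [Real.exp_pos (-x ^ 2)]

lemma fastLim_macInt {j : ℕ} {μ : ℂ} (hj : j ≤ 1) (hμ : μ.re = 1) :
    FastLim (macInt j μ) (gammaLog j μ) := by
  refine IsBigO.of_bound (∫ s, 4 * Real.exp (-(1 / 4) * |s|)) (.of_forall fun r => ?_)
  rw [macInt, gammaLog, ← integral_sub (integrable_macKer hj (by simp [hμ]) r)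
    (integrable_gammaLog hj hμ), Real.norm_of_nonneg (Real.exp_pos r).le, ← integral_mul_const]
  refine norm_integral_le_of_norm_le
    (((integrable_exp_neg_mul_abs (by norm_num)).const_mul 4).mul_const _) (.of_forall fun s => ?_)
  have h1 : macKer j μ r s - (s : ℂ) ^ j * Complex.exp (μ * s) * (Real.exp (-Real.exp s) : ℝ) =
      (s : ℂ) ^ j * Complex.exp (μ * s) * (Real.exp (-Real.exp s) : ℝ) *
        ((Real.exp (-Real.exp (2 * r - s)) - 1 : ℝ) : ℂ) := by
    rw [macKer, neg_add, Real.exp_add]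
    push_cast
    ring
  have h2 : |Real.exp (-Real.exp (2 * r - s)) - 1| ≤ Real.exp (r - s / 2) := by
    have h := one_sub_exp_neg_sq_le (Real.exp_pos (r - s / 2)).le
    rw [← Real.exp_nat_mul, show ((2 : ℕ) : ℝ) * (r - s / 2) = 2 * r - s by push_cast; ring] at h
    rw [abs_sub_comm, abs_of_nonneg]
    · exact h
    · simp [Real.exp_nonneg]
  rw [h1, norm_mul, norm_gammaLog_integrand hμ, Complex.norm_real, Real.norm_eq_abs]
  calc _ ≤ |s| ^ j * Real.exp s * Real.exp (-Real.exp s) * Real.exp (r - s / 2) := by gcongr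
    _ = |s| ^ j * (Real.exp (s / 2) * Real.exp (-Real.exp s)) * Real.exp r := by
        rw [show s = s / 2 + s / 2 by ring, Real.exp_add, show r - (s / 2 + s / 2) / 2 = r - s / 2
          by ring, Real.exp_sub, show (s / 2 + s / 2) / 2 = s / 2 by ring]
        field_simp
    _ ≤ (4 * Real.exp (|s| / 4)) * Real.exp (-(1 / 2) * |s|) * Real.exp r := by
        gcongr
        · exact abs_pow_le_exp hj s
        · exact exp_half_mul_exp_neg_exp_le s
    _ = 4 * (Real.exp (|s| / 4) * Real.exp (-(1 / 2) * |s|)) * Real.exp r := by ring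
    _ = _ := by rw [← Real.exp_add]; congr 3; ring

lemma integral_Ioi_eq_integral_exp (g : ℝ → ℂ) :
    ∫ t in Ioi (0 : ℝ), g t = ∫ s : ℝ, (Real.exp s : ℂ) * g (Real.exp s) := by
  have h := integral_image_eq_integral_abs_deriv_smul (s := univ) (f := Real.exp) (f' := Real.exp)
    MeasurableSet.univ (fun x _ => (Real.hasDerivAt_exp x).hasDerivWithinAt)
    Real.exp_injective.injOn g
  rw [image_univ, Real.range_exp] at h
  rw [h, Measure.restrict_univ]
  congr 1 with s
  rw [abs_of_pos (Real.exp_pos s), Complex.real_smul]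

lemma ofReal_exp_mul_cpow_sub_one (s : ℝ) (μ : ℂ) :
    (Real.exp s : ℂ) * (Real.exp s : ℂ) ^ (μ - 1) = Complex.exp (μ * s) := by
  have h0 : (Real.exp s : ℂ) ≠ 0 := by exact_mod_cast (Real.exp_pos s).ne'
  rw [Complex.cpow_sub _ _ h0, Complex.cpow_one, mul_div_cancel₀ _ h0,
    Complex.cpow_def_of_ne_zero h0, ← Complex.ofReal_log (Real.exp_pos s).le, Real.log_exp,
    mul_comm]

lemma gammaLog_zero {μ : ℂ} (hμ : μ.re = 1) : gammaLog 0 μ = Complex.Gamma μ := by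
  rw [Complex.Gamma_eq_integral (by simp [hμ]), Complex.GammaIntegral,
    integral_Ioi_eq_integral_exp, gammaLog]
  congr 1 with s
  rw [mul_left_comm, ofReal_exp_mul_cpow_sub_one]
  ring

lemma hasDerivAt_Gamma {μ : ℂ} (hμ : μ.re = 1) :
    HasDerivAt Complex.Gamma (gammaLog 1 μ) μ := by
  have h := Complex.hasDerivAt_GammaIntegral (s := μ) (by simp [hμ])
  have hn : ∀ᶠ z in 𝓝 μ, Complex.Gamma z = Complex.GammaIntegral z := by
    filter_upwards [(isOpen_lt continuous_const Complex.continuous_re).mem_nhds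
      (show (0 : ℝ) < μ.re by simp [hμ])] with z hz
    exact Complex.Gamma_eq_integral hz
  refine (h.congr_of_eventuallyEq hn).congr_deriv ?_
  rw [integral_Ioi_eq_integral_exp, gammaLog]
  congr 1 with s
  rw [← mul_assoc, ofReal_exp_mul_cpow_sub_one, Real.log_exp]
  ring

/-! ### The Macdonald function -/

section
variable {ν : ℂ}

lemma cexp_two_mul_sq (ν : ℂ) (r : ℝ) :
    Complex.exp (-2 * (1 - ν) * r) * Complex.exp (2 * r) = Complex.exp (ν * r) ^ 2 := by
  rw [← Complex.exp_add, ← Complex.exp_nat_mul]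
  congr 1
  push_cast
  ring

lemma cexp_neg_two_mul (ν : ℂ) (r : ℝ) :
    Complex.exp (-2 * ν * r) = Complex.exp (-ν * r) ^ 2 := by
  rw [← Complex.exp_nat_mul]
  congr 1
  push_cast
  ring

lemma cexp_mul_cexp_neg (ν : ℂ) (r : ℝ) : Complex.exp (ν * r) * Complex.exp (-ν * r) = 1 := by
  rw [← Complex.exp_add, ← Complex.exp_zero]
  congr 1
  ring

lemma macInt_zero_relation (hν : ν.re = 0) (r : ℝ) :
    ν * macInt 0 ν r = macInt 0 (1 + ν) r - Complex.exp (ν * r) ^ 2 * macInt 0 (1 - ν) r := by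
  have h := macInt_parts (j := 0) zero_le_one hν r
  rw [show ν - 1 = -(1 - ν) by ring, macInt_zero_neg] at h
  linear_combination h - macInt 0 (1 - ν) r * cexp_two_mul_sq ν r

lemma macInt_one_relation (hν : ν.re = 0) (r : ℝ) :
    macInt 0 ν r + ν * macInt 1 ν r = macInt 1 (1 + ν) r -
      Complex.exp (ν * r) ^ 2 * (2 * r * macInt 0 (1 - ν) r - macInt 1 (1 - ν) r) := by
  have h := macInt_parts (j := 1) le_rfl hν r
  rw [show ν - 1 = -(1 - ν) by ring, macInt_one_neg (by simp [hν])] at h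
  simp only [Nat.cast_one, tsub_self] at h
  linear_combination h -
    (2 * r * macInt 0 (1 - ν) r - macInt 1 (1 - ν) r) * cexp_two_mul_sq ν r

lemma hasDerivAt_macInt_one_add {j : ℕ} (hj : j ≤ 1) (hν : ν.re = 0) (r : ℝ) :
    HasDerivAt (macInt j (1 + ν)) (-2 * Complex.exp (2 * r) * macInt j ν r) r := by
  have h := hasDerivAt_macInt (μ := 1 + ν) hj (by simp [hν]) (by simp [hν]) r
  rwa [add_sub_cancel_left] at h

lemma hasDerivAt_macInt_zero_one_sub (hν : ν.re = 0) (r : ℝ) :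
    HasDerivAt (macInt 0 (1 - ν))
      (-2 * Complex.exp (2 * r) * (Complex.exp (-ν * r) ^ 2 * macInt 0 ν r)) r := by
  have h := hasDerivAt_macInt_one_add (ν := -ν) zero_le_one (by simp [hν]) r
  rwa [← sub_eq_add_neg, macInt_zero_neg, cexp_neg_two_mul] at h

lemma hasDerivAt_macInt_one_one_sub (hν : ν.re = 0) (r : ℝ) :
    HasDerivAt (macInt 1 (1 - ν)) (-2 * Complex.exp (2 * r) *
      (Complex.exp (-ν * r) ^ 2 * (2 * r * macInt 0 ν r - macInt 1 ν r))) r := by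
  have h := hasDerivAt_macInt_one_add (ν := -ν) le_rfl (by simp [hν]) r
  rwa [← sub_eq_add_neg, macInt_one_neg (by simp [hν]), cexp_neg_two_mul] at h

/-- The Macdonald function `K_ν (2 exp r)`. -/
noncomputable def macK (ν : ℂ) (r : ℝ) : ℂ :=
  (Complex.exp (-ν * r) * macInt 0 (1 + ν) r - Complex.exp (ν * r) * macInt 0 (1 - ν) r) / (2 * ν)

/-- The derivative of `macK`. -/
noncomputable def macK' (ν : ℂ) (r : ℝ) : ℂ :=
  -(Complex.exp (-ν * r) * macInt 0 (1 + ν) r + Complex.exp (ν * r) * macInt 0 (1 - ν) r) / 2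

lemma hasDerivAt_macK (hν : ν.re = 0) (h0 : ν ≠ 0) (r : ℝ) :
    HasDerivAt (macK ν) (macK' ν r) r := by
  have h := (((hasDerivAt_cexp_mul (-ν) r).mul (hasDerivAt_macInt_one_add zero_le_one hν r)).sub
    ((hasDerivAt_cexp_mul ν r).mul (hasDerivAt_macInt_zero_one_sub hν r))).div_const (2 * ν)
  refine h.congr_deriv ?_
  have h1 := cexp_mul_cexp_neg ν r
  rw [macK', div_eq_div_iff (by simpa using h0) two_ne_zero]
  linear_combination (-2 * -2 * Complex.exp (2 * r) * Complex.exp (-ν * r) * macInt 0 ν r) * h1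

lemma two_mul_macK (h0 : ν ≠ 0) (r : ℝ) : 2 * ν * macK ν r =
    Complex.exp (-ν * r) * macInt 0 (1 + ν) r - Complex.exp (ν * r) * macInt 0 (1 - ν) r := by
  rw [macK, mul_div_cancel₀ _ (by simpa using h0)]

lemma cexp_mul_macInt_zero (hν : ν.re = 0) (h0 : ν ≠ 0) (r : ℝ) :
    Complex.exp (-ν * r) * macInt 0 ν r = 2 * macK ν r := by
  refine mul_left_cancel₀ h0 ?_
  linear_combination Complex.exp (-ν * r) * macInt_zero_relation hν r - two_mul_macK h0 r -
    Complex.exp (ν * r) * macInt 0 (1 - ν) r * cexp_mul_cexp_neg ν r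

lemma hasDerivAt_macK' (hν : ν.re = 0) (h0 : ν ≠ 0) (r : ℝ) :
    HasDerivAt (macK' ν) ((ν ^ 2 + 4 * Complex.exp (2 * r)) * macK ν r) r := by
  have h := (((hasDerivAt_cexp_mul (-ν) r).mul (hasDerivAt_macInt_one_add zero_le_one hν r)).add
    ((hasDerivAt_cexp_mul ν r).mul (hasDerivAt_macInt_zero_one_sub hν r))).neg.div_const 2
  refine h.congr_deriv ?_
  linear_combination -(ν / 2) * two_mul_macK h0 r +
    Complex.exp (2 * r) * Complex.exp (-ν * r) * macInt 0 ν r * cexp_mul_cexp_neg ν r +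
    2 * Complex.exp (2 * r) * cexp_mul_macInt_zero hν h0 r

lemma Gamma_mul_Gamma_eq (h0 : ν ≠ 0) (hs : Complex.sin (π * ν) ≠ 0) :
    Complex.Gamma (1 + ν) * Complex.Gamma (1 - ν) * Complex.sin (π * ν) = π * ν := by
  have h := Complex.Gamma_mul_Gamma_one_sub ν
  rw [eq_div_iff hs] at h
  rw [add_comm, Complex.Gamma_add_one ν h0]
  linear_combination ν * h

lemma Gamma_ne_zero_of_re_eq_one {μ : ℂ} (hμ : μ.re = 1) : Complex.Gamma μ ≠ 0 :=
  Complex.Gamma_ne_zero_of_re_pos (by simp [hμ])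

lemma fastLim_besselCoeff {ε : ℂ} (hε : ‖ε‖ ≤ 1) (hν : ν.re = 0) :
    FastLim (expSeries (besselCoeff ε ν)) (Complex.Gamma (1 + ν))⁻¹ := by
  have h := (entireCoeff_besselCoeff hε hν).fastLim
  simpa [besselCoeff, add_comm] using h

lemma fastLim_mul_index {c : ℕ → ℂ} (hc : EntireCoeff c) :
    FastLim (expSeries fun k => 2 * k * c k) 0 := by
  simpa using hc.mul_index.fastLim

lemma fastLim_gamma (hν : ν.re = 0) : FastLim (macInt 0 (1 + ν)) (Complex.Gamma (1 + ν)) := by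
  rw [← gammaLog_zero (by simp [hν])]
  exact fastLim_macInt zero_le_one (by simp [hν])

lemma FastLim.tendsto_exp_mul_of_zero {f : ℝ → ℂ} {a lam : ℂ} (hf : FastLim f a) (ha : a = 0)
    (hl : lam.re = 0) : Tendsto (fun r : ℝ => Complex.exp (lam * r) * f r) atBot (𝓝 0) := by
  simpa [ha] using hf.tendsto_exp_mul hl

lemma besselK_eq_macK (hν : ν.re = 0) (h0 : ν ≠ 0) (hs : Complex.sin (π * ν) ≠ 0) (r : ℝ) :
    besselK ν ((2 * Real.exp r : ℝ) : ℂ) = macK ν r := by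
  have hν' : (-ν).re = 0 := by simp [hν]
  have h1 : ‖(1 : ℂ)‖ ≤ 1 := by simp
  set b : ℂ := π / (2 * Complex.sin (π * ν)) with hb
  set i := expSeries (besselCoeff 1 ν)
  set i' := expSeries fun k => 2 * k * besselCoeff 1 ν k
  set m := expSeries (besselCoeff 1 (-ν))
  set m' := expSeries fun k => 2 * k * besselCoeff 1 (-ν) k
  have hi := (entireCoeff_besselCoeff h1 hν).hasDerivAt
  have hi' : ∀ r : ℝ, HasDerivAt i' (-(2 * ν) * i' r + 4 * Complex.exp (2 * r) * i r) r := fun r =>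
    ((entireCoeff_besselCoeff h1 hν).mul_index.hasDerivAt r).congr_deriv
      ((expSeries_besselCoeff_ode h1 hν r).trans (by ring))
  have hm := (entireCoeff_besselCoeff h1 hν').hasDerivAt
  have hm' : ∀ r : ℝ, HasDerivAt m' (2 * ν * m' r + 4 * Complex.exp (2 * r) * m r) r := fun r =>
    ((entireCoeff_besselCoeff h1 hν').mul_index.hasDerivAt r).congr_deriv
      ((expSeries_besselCoeff_ode h1 hν' r).trans (by ring))
  have hE := hasDerivAt_cexp_mul ν
  have hF := hasDerivAt_cexp_mul (-ν)
  have Li := fastLim_besselCoeff h1 hν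
  have Lm := fastLim_besselCoeff h1 hν'
  have Li' := fastLim_mul_index (entireCoeff_besselCoeff h1 hν)
  have Lm' := fastLim_mul_index (entireCoeff_besselCoeff h1 hν')
  have Lp := fastLim_gamma hν
  have Lq := fastLim_gamma hν'
  rw [← sub_eq_add_neg] at Lq Lm
  have gp := Gamma_ne_zero_of_re_eq_one (μ := 1 + ν) (by simp [hν])
  have gm := Gamma_ne_zero_of_re_eq_one (μ := 1 - ν) (by simp [hν])
  have hG := Gamma_mul_Gamma_eq h0 hs
  have hb1 : 2 * ν * b = Complex.Gamma (1 + ν) * Complex.Gamma (1 - ν) := by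
    rw [hb, mul_div_assoc', div_eq_iff (mul_ne_zero two_ne_zero hs)]
    linear_combination -2 * hG
  have key := second_order_eq_zero hν h0
    (d := fun r => macK ν r - b * (Complex.exp (-ν * r) * m r - Complex.exp (ν * r) * i r))
    (d1 := fun r => macK' ν r - b * (Complex.exp (-ν * r) * (m' r - ν * m r) -
      Complex.exp (ν * r) * (i' r + ν * i r)))
    (fun r => ((hasDerivAt_macK hν h0 r).sub ((((hF r).mul (hm r)).sub
      ((hE r).mul (hi r))).const_mul b)).congr_deriv (by ring))
    (fun r => ((hasDerivAt_macK' hν h0 r).sub ((((hF r).mul ((hm' r).sub ((hm r).const_mul ν))).sub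
      ((hE r).mul ((hi' r).add ((hi r).const_mul ν)))).const_mul b)).congr_deriv (by
        simp only [Pi.add_apply, Pi.sub_apply]; ring)) ?_ ?_ r
  · rw [sub_eq_zero] at key
    rw [key, besselK, besselI_eq_expSeries, besselI_eq_expSeries, hb]
    ring
  · have t1 := ((Lp.const_mul (1 / (2 * ν))).sub (Lm.const_mul b)).tendsto_exp_mul_of_zero
      (lam := -ν) (by rw [← mul_right_inj' h0]; field_simp; linear_combination -hb1) hν'
    have t2 := ((Lq.const_mul (1 / (2 * ν))).sub (Li.const_mul b)).tendsto_exp_mul_of_zero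
      (lam := ν) (by rw [← mul_right_inj' h0]; field_simp; linear_combination -hb1) hν
    have t := t1.sub t2
    rw [sub_zero] at t
    refine t.congr fun r => ?_
    rw [macK]
    ring
  · have t1 := ((Lp.const_mul (-1 / 2)).sub ((Lm'.sub (Lm.const_mul ν)).const_mul b)).tendsto_exp_mul_of_zero
      (lam := -ν) (by field_simp; linear_combination hb1) hν'
    have t2 := ((Lq.const_mul (1 / 2)).sub ((Li'.add (Li.const_mul ν)).const_mul b)).tendsto_exp_mul_of_zero
      (lam := ν) (by field_simp; linear_combination -hb1) hν
    have t := t1.sub t2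
    rw [sub_zero] at t
    refine t.congr fun r => ?_
    rw [macK']
    ring
end

/-! ### Convolution with the logistic density -/

/-- The logistic density, the derivative of `s ↦ Real.sigmoid (2 * s)`. -/
noncomputable def logisKer (s : ℝ) : ℝ := 2 * (Real.sigmoid (2 * s) * Real.sigmoid (-(2 * s)))

/-- Convolution with the logistic density. -/
noncomputable def smooth (f : ℝ → ℂ) (r : ℝ) : ℂ := ∫ s, f (s + r) * (logisKer s : ℂ)

lemma sigmoid_le_exp (x : ℝ) : Real.sigmoid x ≤ Real.exp x := by
  rw [Real.sigmoid_def, ← inv_inv (Real.exp x), ← Real.exp_neg]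
  exact inv_anti₀ (Real.exp_pos _) (by linarith)

@[fun_prop]
lemma continuous_logisKer : Continuous logisKer := by
  have := continuous_sigmoid
  unfold logisKer
  fun_prop

lemma logisKer_nonneg (s : ℝ) : 0 ≤ logisKer s :=
  mul_nonneg two_pos.le (mul_nonneg (Real.sigmoid_nonneg _) (Real.sigmoid_nonneg _))

lemma logisKer_le (s : ℝ) : logisKer s ≤ 2 * Real.exp (-2 * |s|) := by
  rw [logisKer]
  gcongr
  rcases le_total 0 s with h | h
  · rw [abs_of_nonneg h, ← one_mul (Real.exp _), ← neg_mul]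
    exact mul_le_mul (Real.sigmoid_le_one _) (sigmoid_le_exp _) (Real.sigmoid_nonneg _) one_pos.le
  · rw [abs_of_nonpos h, ← mul_one (Real.exp _), neg_mul_neg]
    exact mul_le_mul (sigmoid_le_exp _) (Real.sigmoid_le_one _) (Real.sigmoid_nonneg _)
      (Real.exp_pos _).le

lemma logisKer_neg (s : ℝ) : logisKer (-s) = logisKer s := by
  rw [logisKer, logisKer, mul_neg, neg_neg, mul_comm (Real.sigmoid _)]

lemma hasDerivAt_sigmoid_two_mul (s : ℝ) :
    HasDerivAt (fun s => Real.sigmoid (2 * s)) (logisKer s) s := by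
  have h := (hasDerivAt_sigmoid (2 * s)).comp s ((hasDerivAt_id s).const_mul 2)
  exact h.congr_deriv (by rw [logisKer, Real.sigmoid_neg]; ring)

lemma one_add_abs_mul_logisKer_le (s : ℝ) :
    (1 + |s|) * logisKer s ≤ 2 * Real.exp (-1 * |s|) := by
  have h1 : 1 + |s| ≤ Real.exp |s| := by linarith [Real.add_one_le_exp |s|]
  calc _ ≤ Real.exp |s| * (2 * Real.exp (-2 * |s|)) :=
        mul_le_mul h1 (logisKer_le s) (logisKer_nonneg s) (Real.exp_pos _).le
    _ = 2 * (Real.exp |s| * Real.exp (-2 * |s|)) := by ring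
    _ = _ := by rw [← Real.exp_add]; congr 2; ring

lemma integrable_mul_logisKer {f : ℝ → ℂ} (hf : Continuous f) {C : ℝ} (hC : 0 ≤ C)
    (h : ∀ s, ‖f s‖ ≤ C * (1 + |s|)) : Integrable fun s => f s * (logisKer s : ℂ) := by
  refine integrable_of_norm_le_exp (b := 1) (C := C * 2) (by fun_prop) one_pos fun s => ?_
  rw [norm_mul, Complex.norm_real, Real.norm_of_nonneg (logisKer_nonneg s)]
  calc _ ≤ C * (1 + |s|) * logisKer s := by gcongr; exacts [logisKer_nonneg s, h s]
    _ = C * ((1 + |s|) * logisKer s) := by ring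
    _ ≤ C * (2 * Real.exp (-1 * |s|)) :=
        mul_le_mul_of_nonneg_left (one_add_abs_mul_logisKer_le s) hC
    _ = _ := by ring

/-- `f` grows at most linearly. -/
def LinGrowth (f : ℝ → ℂ) : Prop := ∃ C, 0 ≤ C ∧ ∀ s, ‖f s‖ ≤ C * (1 + |s|)

lemma LinGrowth.shift {f : ℝ → ℂ} (hf : LinGrowth f) (r : ℝ) : LinGrowth fun s => f (s + r) := by
  obtain ⟨C, hC, h⟩ := hf
  refine ⟨C * (1 + |r|), by positivity, fun s => (h _).trans ?_⟩
  rw [mul_assoc]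
  gcongr
  nlinarith [abs_add_le s r, abs_nonneg s, abs_nonneg r, mul_nonneg (abs_nonneg s) (abs_nonneg r)]

lemma LinGrowth.integrable {f : ℝ → ℂ} (hg : LinGrowth f) (hf : Continuous f) (r : ℝ) :
    Integrable fun s => f (s + r) * (logisKer s : ℂ) := by
  obtain ⟨C, hC, h⟩ := hg.shift r
  exact integrable_mul_logisKer (by fun_prop) hC h

lemma hasDerivAt_smooth {f f' : ℝ → ℂ} (hf : ∀ s, HasDerivAt f (f' s) s) (hg : LinGrowth f)
    (hc : Continuous f') {C : ℝ} (hC : ∀ s, ‖f' s‖ ≤ C) (r : ℝ) :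
    HasDerivAt (smooth f) (smooth f' r) r := by
  have hcf : Continuous f := continuous_iff_continuousAt.2 fun s => (hf s).continuousAt
  have hC0 : 0 ≤ C := (norm_nonneg _).trans (hC 0)
  refine (hasDerivAt_integral_of_dominated_loc_of_deriv_le (μ := volume) (x₀ := r) (s := univ)
    (F := fun r s => f (s + r) * (logisKer s : ℂ)) (F' := fun r s => f' (s + r) * (logisKer s : ℂ))
    (bound := fun s => C * (2 * Real.exp (-2 * |s|))) univ_mem
    (.of_forall fun r => Continuous.aestronglyMeasurable (by fun_prop)) (hg.integrable hcf r)
    (Continuous.aestronglyMeasurable (by fun_prop))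
    (.of_forall fun s x _ => ?_)
    (((integrable_exp_neg_mul_abs two_pos).const_mul 2).const_mul C)
    (.of_forall fun s x _ => ?_)).2
  · rw [norm_mul, Complex.norm_real, Real.norm_of_nonneg (logisKer_nonneg s)]
    exact mul_le_mul (hC _) (logisKer_le s) (logisKer_nonneg s) hC0
  · exact ((hf (s + x)).comp_const_add s x).mul_const _

lemma integral_cexp_mul_logisKer {ν : ℂ} (hν : ν.re = 0) :
    ∫ s : ℝ, Complex.exp (2 * ν * s) * (logisKer s : ℂ) =
      Complex.Gamma (1 + ν) * Complex.Gamma (1 - ν) := by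
  rw [Complex.Gamma_mul_Gamma_eq_betaIntegral (by simp [hν]) (by simp [hν]),
    show (1 + ν) + (1 - ν) = 1 + 1 by ring, Complex.Gamma_add_one 1 one_ne_zero, Complex.Gamma_one,
    Complex.betaIntegral, intervalIntegral.integral_of_le zero_le_one, integral_Ioc_eq_integral_Ioo]
  have hinj : Function.Injective fun s : ℝ => Real.sigmoid (2 * s) := fun a b h => by
    have := Real.sigmoid_injective h
    linarith
  have himg : (fun s : ℝ => Real.sigmoid (2 * s)) '' univ = Ioo 0 1 := by
    rw [image_univ, ← Real.range_sigmoid]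
    exact (mul_left_surjective₀ (two_ne_zero (α := ℝ))).range_comp Real.sigmoid
  have h := integral_image_eq_integral_abs_deriv_smul (s := univ)
    MeasurableSet.univ (fun x _ => (hasDerivAt_sigmoid_two_mul x).hasDerivWithinAt) hinj.injOn
    fun x : ℝ => (x : ℂ) ^ (1 + ν - 1) * (1 - (x : ℂ)) ^ (1 - ν - 1)
  rw [himg] at h
  rw [h, Measure.restrict_univ, one_mul, one_mul]
  congr 1 with s
  have e1 : (1 : ℂ) - (Real.sigmoid (2 * s) : ℂ) = (Real.sigmoid (-(2 * s)) : ℝ) := by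
    rw [Real.sigmoid_neg]; push_cast; rfl
  have p1 := Real.sigmoid_pos (2 * s)
  have p2 := Real.sigmoid_pos (-(2 * s))
  have hl : Real.log (Real.sigmoid (2 * s)) = Real.log (Real.sigmoid (-(2 * s))) + 2 * s := by
    rw [← Real.sigmoid_mul_rexp_neg, Real.log_mul p1.ne' (Real.exp_pos _).ne', Real.log_exp]
    ring
  rw [abs_of_nonneg (logisKer_nonneg s), Complex.real_smul, e1,
    Complex.cpow_def_of_ne_zero (by exact_mod_cast p1.ne'),
    Complex.cpow_def_of_ne_zero (by exact_mod_cast p2.ne'), ← Complex.exp_add,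
    ← Complex.ofReal_log p1.le, ← Complex.ofReal_log p2.le, hl, mul_comm]
  congr 2
  push_cast
  ring

lemma integral_logisKer : ∫ s : ℝ, (logisKer s : ℂ) = 1 := by
  simpa using integral_cexp_mul_logisKer (ν := 0) (by simp)

lemma integral_id_mul_logisKer : ∫ s : ℝ, (s : ℂ) * (logisKer s : ℂ) = 0 := by
  have h := integral_neg_eq_self (fun s : ℝ => (s : ℂ) * (logisKer s : ℂ)) volume
  simp only [logisKer_neg, Complex.ofReal_neg, neg_mul] at h
  rw [integral_neg] at h
  linear_combination (-1 / 2) * h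

/-- The functions that describe the behaviour of the iterated primitives at `-∞`. -/
noncomputable def linExp (ν α c β γ : ℂ) (s : ℝ) : ℂ :=
  α * s + c + β * Complex.exp (2 * ν * s) + γ * Complex.exp (-(2 * ν) * s)

lemma linGrowth_linExp {ν : ℂ} (hν : ν.re = 0) (α c β γ : ℂ) : LinGrowth (linExp ν α c β γ) := by
  refine ⟨‖α‖ + ‖c‖ + ‖β‖ + ‖γ‖, by positivity, fun s => ?_⟩
  have h1 : ‖Complex.exp (2 * ν * s)‖ = 1 := norm_cexp_mul_ofReal (by simp [hν]) s
  have h2 : ‖Complex.exp (-(2 * ν) * s)‖ = 1 := norm_cexp_mul_ofReal (by simp [hν]) s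
  have h3 : ‖linExp ν α c β γ s‖ ≤ ‖α‖ * |s| + ‖c‖ + ‖β‖ + ‖γ‖ := by
    refine (norm_add₄_le ..).trans (le_of_eq ?_)
    rw [norm_mul, norm_mul, norm_mul, h1, h2, Complex.norm_real, Real.norm_eq_abs, mul_one, mul_one]
  have := abs_nonneg s
  nlinarith [norm_nonneg α, norm_nonneg β, norm_nonneg γ, norm_nonneg c,
    mul_nonneg (norm_nonneg β) this, mul_nonneg (norm_nonneg γ) this,
    mul_nonneg (norm_nonneg c) this]

lemma continuous_linExp (ν α c β γ : ℂ) : Continuous (linExp ν α c β γ) := by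
  unfold linExp
  fun_prop

lemma smooth_linExp {ν : ℂ} (hν : ν.re = 0) (α c β γ : ℂ) (r : ℝ) :
    smooth (linExp ν α c β γ) r = α * r + c + Complex.Gamma (1 + ν) * Complex.Gamma (1 - ν) *
      (β * Complex.exp (2 * ν * r) + γ * Complex.exp (-(2 * ν) * r)) := by
  have hlin : ∀ α c β γ : ℂ, Integrable fun s => linExp ν α c β γ s * (logisKer s : ℂ) := by
    intro α c β γ
    simpa using (linGrowth_linExp hν α c β γ).integrable (continuous_linExp ν α c β γ) 0
  have i1 := hlin 1 0 0 0
  have i2 := hlin 0 1 0 0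
  have i3 := hlin 0 0 1 0
  have i4 := hlin 0 0 0 1
  simp only [linExp, one_mul, zero_mul, zero_add, add_zero] at i1 i2 i3 i4
  have e : ∀ s : ℝ, linExp ν α c β γ (s + r) * (logisKer s : ℂ) =
      α * (s * (logisKer s : ℂ)) + (α * r + c) * (logisKer s : ℂ) +
      β * Complex.exp (2 * ν * r) * (Complex.exp (2 * ν * s) * (logisKer s : ℂ)) +
      γ * Complex.exp (-(2 * ν) * r) * (Complex.exp (-(2 * ν) * s) * (logisKer s : ℂ)) := by
    intro s
    simp only [linExp, Complex.ofReal_add, mul_add, Complex.exp_add]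
    ring
  have h4 := integral_cexp_mul_logisKer (ν := -ν) (by simp [hν])
  rw [mul_neg, sub_neg_eq_add, ← sub_eq_add_neg] at h4
  simp only [smooth, e]
  have j2 : Integrable fun s : ℝ => α * (s * (logisKer s : ℂ)) + (α * r + c) * (logisKer s : ℂ) :=
    (i1.const_mul α).add (i2.const_mul _)
  have j3 : Integrable fun s : ℝ => α * (s * (logisKer s : ℂ)) + (α * r + c) * (logisKer s : ℂ) +
      β * Complex.exp (2 * ν * r) * (Complex.exp (2 * ν * s) * (logisKer s : ℂ)) :=
    j2.add (i3.const_mul _)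
  rw [integral_add j3 (i4.const_mul _), integral_add j2 (i3.const_mul _),
    integral_add (i1.const_mul α) (i2.const_mul _), integral_const_mul, integral_const_mul,
    integral_const_mul, integral_const_mul, integral_id_mul_logisKer, integral_logisKer,
    integral_cexp_mul_logisKer hν, h4]
  ring

lemma exists_norm_le_Iic {f : ℝ → ℂ} (hf : Continuous f) {l : ℂ} (h : Tendsto f atBot (𝓝 l)) :
    ∃ C, 0 ≤ C ∧ ∀ s ≤ 0, ‖f s‖ ≤ C := by
  obtain ⟨a, ha⟩ := eventually_atBot.1
    (h.norm.eventually (eventually_le_nhds (lt_add_one ‖l‖)))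
  obtain ⟨C, hC⟩ := (isCompact_Icc (a := a) (b := 0)).exists_bound_of_continuousOn hf.continuousOn
  refine ⟨max (‖l‖ + 1) C, le_max_of_le_left (by positivity), fun s hs => ?_⟩
  rcases le_total s a with h1 | h1
  · exact (ha s h1).trans (le_max_left _ _)
  · exact (hC s ⟨h1, hs⟩).trans (le_max_right _ _)

lemma exists_norm_le_Ici {f : ℝ → ℂ} (hf : Continuous f) {l : ℂ} (h : Tendsto f atTop (𝓝 l)) :
    ∃ C, 0 ≤ C ∧ ∀ s, 0 ≤ s → ‖f s‖ ≤ C := by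
  obtain ⟨C, h0, hC⟩ := exists_norm_le_Iic (hf.comp continuous_neg) (h.comp tendsto_neg_atBot_atTop)
  exact ⟨C, h0, fun s hs => by simpa using hC (-s) (by linarith)⟩

section
variable {ν α c β γ : ℂ} {f : ℝ → ℂ}

lemma exists_norm_sub_linExp_le (hν : ν.re = 0) (hf : Continuous f) (hT : Tendsto f atTop (𝓝 0))
    (hB : Tendsto (fun s => f s - linExp ν α c β γ s) atBot (𝓝 0)) :
    ∃ C, 0 ≤ C ∧ ∀ s, ‖f s - linExp ν α c β γ s‖ ≤ C * (1 + max s 0) := by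
  have hl := continuous_linExp ν α c β γ
  obtain ⟨C₁, h1, hC₁⟩ := exists_norm_le_Iic (hf.sub hl) hB
  obtain ⟨C₂, h2, hC₂⟩ := exists_norm_le_Ici hf hT
  obtain ⟨C₃, h3, hC₃⟩ := linGrowth_linExp hν α c β γ
  refine ⟨C₁ + C₂ + C₃, by positivity, fun s => ?_⟩
  rcases le_total s 0 with h | h
  · rw [max_eq_right h]
    exact (hC₁ s h).trans (by linarith)
  · rw [max_eq_left h]
    have e := hC₃ s
    rw [abs_of_nonneg h] at e
    refine (norm_sub_le _ _).trans ?_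
    nlinarith [hC₂ s h, mul_nonneg h1 h, mul_nonneg h2 h]

lemma linGrowth_of_tendsto (hν : ν.re = 0) (hf : Continuous f) (hT : Tendsto f atTop (𝓝 0))
    (hB : Tendsto (fun s => f s - linExp ν α c β γ s) atBot (𝓝 0)) : LinGrowth f := by
  obtain ⟨C, h0, hC⟩ := exists_norm_sub_linExp_le hν hf hT hB
  obtain ⟨D, h1, hD⟩ := linGrowth_linExp hν α c β γ
  refine ⟨C + D, by positivity, fun s => ?_⟩
  have h2 : max s 0 ≤ |s| := max_le (le_abs_self s) (abs_nonneg s)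
  have h3 := norm_add_le (f s - linExp ν α c β γ s) (linExp ν α c β γ s)
  rw [sub_add_cancel] at h3
  nlinarith [hC s, hD s]

lemma tendsto_smooth_sub (hν : ν.re = 0) (hf : Continuous f) (hT : Tendsto f atTop (𝓝 0))
    (hB : Tendsto (fun s => f s - linExp ν α c β γ s) atBot (𝓝 0)) :
    Tendsto (fun r => smooth f r - smooth (linExp ν α c β γ) r) atBot (𝓝 0) := by
  obtain ⟨C, h0, hC⟩ := exists_norm_sub_linExp_le hν hf hT hB
  have hl := continuous_linExp ν α c β γ
  have e : ∀ r, smooth f r - smooth (linExp ν α c β γ) r =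
      ∫ s, (f (s + r) - linExp ν α c β γ (s + r)) * (logisKer s : ℂ) := by
    intro r
    rw [smooth, smooth, ← integral_sub ((linGrowth_of_tendsto hν hf hT hB).integrable hf r)
      ((linGrowth_linExp hν α c β γ).integrable hl r)]
    simp only [sub_mul]
  simp only [e]
  have h := tendsto_integral_filter_of_dominated_convergence (μ := volume) (l := atBot)
    (F := fun r s => (f (s + r) - linExp ν α c β γ (s + r)) * (logisKer s : ℂ))
    (f := fun _ => (0 : ℂ)) (fun s => C * (2 * Real.exp (-1 * |s|)))
    (.of_forall fun r => Continuous.aestronglyMeasurable (by fun_prop)) ?_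
    (((integrable_exp_neg_mul_abs one_pos).const_mul 2).const_mul C)
    (.of_forall fun s => by
      simpa using (hB.comp (tendsto_atBot_add_const_left atBot s tendsto_id)).mul_const _)
  · simpa using h
  · filter_upwards [eventually_le_atBot 0] with r hr
    refine .of_forall fun s => ?_
    rw [norm_mul, Complex.norm_real, Real.norm_of_nonneg (logisKer_nonneg s)]
    have h2 : max (s + r) 0 ≤ |s| := max_le (by linarith [le_abs_self s]) (abs_nonneg s)
    calc _ ≤ C * (1 + |s|) * logisKer s := by
          gcongr
          · exact logisKer_nonneg s
          · exact (hC _).trans (by gcongr)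
      _ = C * ((1 + |s|) * logisKer s) := by ring
      _ ≤ _ := mul_le_mul_of_nonneg_left (one_add_abs_mul_logisKer_le s) h0

end

/-! ### The Stieltjes transform in logarithmic variables -/

/-- The Stieltjes transform in logarithmic variables. -/
noncomputable def stieltjes (f : ℝ → ℂ) (r : ℝ) : ℂ :=
  ∫ s, f s * (Real.sigmoid (2 * (s - r)) : ℂ)

/-- `f` is bounded and decays double exponentially at `+∞`. -/
def SuperDecay (f : ℝ → ℂ) : Prop := ∃ C, 0 ≤ C ∧ ∀ s, ‖f s‖ ≤ C * Real.exp (-Real.exp s)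

lemma exp_neg_exp_le_one (s : ℝ) : Real.exp (-Real.exp s) ≤ 1 := by simp [Real.exp_nonneg]

lemma exp_mul_exp_neg_exp_le (n : ℕ) (s : ℝ) :
    Real.exp (n * s) * Real.exp (-Real.exp s) ≤ n.factorial := by
  have h := Real.pow_div_factorial_le_exp (Real.exp s) (Real.exp_pos s).le n
  rw [div_le_iff₀ (by positivity), ← Real.exp_nat_mul] at h
  rw [Real.exp_neg, ← div_eq_mul_inv, div_le_iff₀ (Real.exp_pos _)]
  linarith

lemma exp_neg_exp_le (s : ℝ) : Real.exp (-Real.exp s) ≤ Real.exp (-s) := by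
  gcongr
  linarith [Real.add_one_le_exp s]

lemma SuperDecay.bounded {f : ℝ → ℂ} (hf : SuperDecay f) : ∃ C, ∀ s, ‖f s‖ ≤ C := by
  obtain ⟨C, h0, hC⟩ := hf
  exact ⟨C, fun s => (hC s).trans (mul_le_of_le_one_right h0 (exp_neg_exp_le_one s))⟩

lemma SuperDecay.add {f g : ℝ → ℂ} (hf : SuperDecay f) (hg : SuperDecay g) :
    SuperDecay fun s => f s + g s := by
  obtain ⟨C, h0, hC⟩ := hf
  obtain ⟨D, h1, hD⟩ := hg
  exact ⟨C + D, by positivity, fun s => (norm_add_le _ _).trans (by linarith [hC s, hD s])⟩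

lemma SuperDecay.bounded_mul {f g : ℝ → ℂ} (hg : SuperDecay g) {C : ℝ} (hf : ∀ s, ‖f s‖ ≤ C) :
    SuperDecay fun s => f s * g s := by
  obtain ⟨D, h1, hD⟩ := hg
  have hC : 0 ≤ C := (norm_nonneg _).trans (hf 0)
  refine ⟨C * D, by positivity, fun s => ?_⟩
  rw [norm_mul, mul_assoc]
  exact mul_le_mul (hf s) (hD s) (norm_nonneg _) hC

lemma SuperDecay.mul {f g : ℝ → ℂ} (hf : SuperDecay f) (hg : SuperDecay g) :
    SuperDecay fun s => f s * g s := by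
  obtain ⟨C, hC⟩ := hf.bounded
  exact hg.bounded_mul hC

lemma SuperDecay.const_mul {f : ℝ → ℂ} (hf : SuperDecay f) (c : ℂ) :
    SuperDecay fun s => c * f s := hf.bounded_mul fun _ => le_refl ‖c‖

lemma SuperDecay.tendsto_id_mul {f : ℝ → ℂ} (hf : SuperDecay f) :
    Tendsto (fun s : ℝ => (s : ℂ) * f s) atTop (𝓝 0) := by
  obtain ⟨C, h0, hC⟩ := hf
  have h : Tendsto (fun s : ℝ => C * (s ^ 1 * Real.exp (-s))) atTop (𝓝 0) := by
    simpa using (Real.tendsto_pow_mul_exp_neg_atTop_nhds_zero 1).const_mul C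
  refine squeeze_zero_norm' ?_ h
  filter_upwards [eventually_ge_atTop 0] with s hs
  rw [norm_mul, Complex.norm_real, Real.norm_of_nonneg hs, pow_one]
  calc _ ≤ s * (C * Real.exp (-s)) := by
        gcongr
        exact (hC s).trans (mul_le_mul_of_nonneg_left (exp_neg_exp_le s) h0)
    _ = _ := by ring

lemma SuperDecay.tendsto {f : ℝ → ℂ} (hf : SuperDecay f) : Tendsto f atTop (𝓝 0) := by
  obtain ⟨C, h0, hC⟩ := hf
  have h : Tendsto (fun s : ℝ => C * Real.exp (-s)) atTop (𝓝 0) := by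
    simpa using (Real.tendsto_exp_neg_atTop_nhds_zero).const_mul C
  exact squeeze_zero_norm (fun s => (hC s).trans (mul_le_mul_of_nonneg_left (exp_neg_exp_le s) h0)) h

/-- `f` is bounded and decays exponentially at `+∞`. -/
def ExpDecay (f : ℝ → ℂ) : Prop := ∃ C, 0 ≤ C ∧ ∀ s, ‖f s‖ ≤ C ∧ ‖f s‖ ≤ C * Real.exp (-s)

lemma SuperDecay.expDecay {f : ℝ → ℂ} (hf : SuperDecay f) : ExpDecay f := by
  obtain ⟨C, h0, hC⟩ := hf
  exact ⟨C, h0, fun s => ⟨(hC s).trans (mul_le_of_le_one_right h0 (exp_neg_exp_le_one s)),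
    (hC s).trans (mul_le_mul_of_nonneg_left (exp_neg_exp_le s) h0)⟩⟩

lemma SuperDecay.exp_two_mul_bounds {f : ℝ → ℂ} (hf : SuperDecay f) : ∃ C, 0 ≤ C ∧
    ∀ s : ℝ, ‖Complex.exp (2 * s) * f s‖ ≤ C ∧ ‖Complex.exp (2 * s) * f s‖ ≤ C * Real.exp (-s) ∧
      ‖Complex.exp (2 * s) * f s‖ ≤ C * Real.exp (2 * s) := by
  obtain ⟨C, h0, hC⟩ := hf
  have hn : ∀ s : ℝ, ‖Complex.exp (2 * s) * f s‖ ≤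
      C * (Real.exp (2 * s) * Real.exp (-Real.exp s)) := by
    intro s
    rw [norm_mul, Complex.norm_exp, show (2 * (s : ℂ)).re = 2 * s by simp]
    nlinarith [hC s, Real.exp_pos (2 * s)]
  have h2 := exp_mul_exp_neg_exp_le 2
  have h3 := exp_mul_exp_neg_exp_le 3
  refine ⟨C * 6, by positivity, fun s => ⟨(hn s).trans ?_, (hn s).trans ?_, (hn s).trans ?_⟩⟩
  · have := h2 s
    norm_num [Nat.factorial] at this
    gcongr
    linarith
  · have := h3 s
    norm_num [Nat.factorial] at this
    rw [mul_assoc]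
    refine mul_le_mul_of_nonneg_left ?_ h0
    rw [show 2 * s = 3 * s + -s by ring, Real.exp_add]
    nlinarith [Real.exp_pos (-s)]
  · rw [mul_assoc]
    refine mul_le_mul_of_nonneg_left ?_ h0
    nlinarith [Real.exp_pos (2 * s), exp_neg_exp_le_one s]

lemma SuperDecay.exp_two_mul {f : ℝ → ℂ} (hf : SuperDecay f) :
    ExpDecay fun s : ℝ => Complex.exp (2 * s) * f s := by
  obtain ⟨C, h0, hC⟩ := hf.exp_two_mul_bounds
  exact ⟨C, h0, fun s => ⟨(hC s).1, (hC s).2.1⟩⟩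

lemma SuperDecay.integrable_exp_two_mul {f : ℝ → ℂ} (hf : SuperDecay f) (hc : Continuous f) :
    Integrable fun s : ℝ => Complex.exp (2 * s) * f s := by
  obtain ⟨C, h0, hC⟩ := hf.exp_two_mul_bounds
  refine integrable_of_norm_le_exp (C := C) (by fun_prop) one_pos fun s => ?_
  rcases le_total 0 s with h | h
  · rw [abs_of_nonneg h, neg_one_mul]
    exact (hC s).2.1
  · rw [abs_of_nonpos h, neg_mul_neg]
    exact (hC s).2.2.trans (mul_le_mul_of_nonneg_left (Real.exp_le_exp.2 (by linarith)) h0)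

lemma ExpDecay.integrable_sigmoid {f : ℝ → ℂ} (hf : ExpDecay f) (hc : Continuous f) (r : ℝ) :
    Integrable fun s => f s * (Real.sigmoid (2 * (s - r)) : ℂ) := by
  obtain ⟨C, h0, hC⟩ := hf
  have hs := continuous_sigmoid
  refine integrable_of_norm_le_exp (C := C * max 1 (Real.exp (-(2 * r)))) (by fun_prop) one_pos
    fun s => ?_
  rw [norm_mul, Complex.norm_real, Real.norm_of_nonneg (Real.sigmoid_nonneg _), mul_assoc C]
  rcases le_total 0 s with h | h
  · rw [abs_of_nonneg h, neg_one_mul]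
    calc _ ≤ C * Real.exp (-s) * 1 := mul_le_mul (hC s).2 (Real.sigmoid_le_one _)
          (Real.sigmoid_nonneg _) (by positivity)
      _ = C * (1 * Real.exp (-s)) := by ring
      _ ≤ _ := by gcongr; exact le_max_left _ _
  · rw [abs_of_nonpos h, neg_mul_neg]
    refine mul_le_mul (hC s).1 ?_ (Real.sigmoid_nonneg _) h0
    calc _ ≤ Real.exp (2 * (s - r)) := sigmoid_le_exp _
      _ ≤ Real.exp (-(2 * r)) * Real.exp (1 * s) := by
          rw [← Real.exp_add]; gcongr; linarith
      _ ≤ _ := by gcongr; exact le_max_right _ _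

lemma LinGrowth.tendsto_mul_sigmoid {f : ℝ → ℂ} (hf : LinGrowth f) (r : ℝ) :
    Tendsto (fun s => f s * (Real.sigmoid (2 * (s - r)) : ℂ)) atBot (𝓝 0) := by
  obtain ⟨C, h0, hC⟩ := hf
  have h : Tendsto (fun s : ℝ => C * Real.exp (-(2 * r)) * Real.exp s) atBot (𝓝 0) := by
    simpa using Real.tendsto_exp_atBot.const_mul (C * Real.exp (-(2 * r)))
  refine squeeze_zero_norm' ?_ h
  filter_upwards [eventually_le_atBot 0] with s hs
  rw [norm_mul, Complex.norm_real, Real.norm_of_nonneg (Real.sigmoid_nonneg _)]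
  have h1 := hC s
  rw [abs_of_nonpos hs] at h1
  calc _ ≤ C * (1 + -s) * Real.exp (2 * (s - r)) :=
        mul_le_mul h1 (sigmoid_le_exp _) (Real.sigmoid_nonneg _) (by nlinarith)
    _ ≤ C * Real.exp (-s) * Real.exp (2 * (s - r)) := by
        gcongr
        linarith [Real.add_one_le_exp (-s)]
    _ = C * (Real.exp (-s) * Real.exp (2 * (s - r))) := by ring
    _ = C * Real.exp (-(2 * r) + s) := by rw [← Real.exp_add]; congr 2; ring
    _ = _ := by rw [Real.exp_add]; ring

lemma smooth_eq_neg_stieltjes {f f' : ℝ → ℂ} (hf : ∀ s, HasDerivAt f (f' s) s)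
    (hg : LinGrowth f) (hT : Tendsto f atTop (𝓝 0)) (hc : Continuous f') (hd : ExpDecay f')
    (r : ℝ) : smooth f r = -stieltjes f' r := by
  have hcf : Continuous f := continuous_iff_continuousAt.2 fun s => (hf s).continuousAt
  have e : ∀ s : ℝ, f s * (logisKer (s - r) : ℂ) =
      f (s - r + r) * (logisKer (s - r) : ℂ) := fun s => by rw [sub_add_cancel]
  have i1 : Integrable fun s => f s * (logisKer (s - r) : ℂ) := by
    simp only [e]
    exact (hg.integrable hcf r).comp_sub_right r
  have e1 : smooth f r = ∫ s, f s * (logisKer (s - r) : ℂ) := by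
    simp only [e]
    rw [integral_sub_right_eq_self (fun s => f (s + r) * (logisKer s : ℂ))]
    rfl
  have i2 := hd.integrable_sigmoid hc r
  have hs : ∀ s, HasDerivAt (fun s => (Real.sigmoid (2 * (s - r)) : ℂ)) (logisKer (s - r)) s :=
    fun s => ((hasDerivAt_sigmoid_two_mul (s - r)).comp_sub_const s r).ofReal_comp
  have hT2 : Tendsto (fun s => (Real.sigmoid (2 * (s - r)) : ℂ)) atTop (𝓝 ((1 : ℝ) : ℂ)) := by
    refine (Complex.continuous_ofReal.tendsto 1).comp (tendsto_sigmoid_atTop.comp ?_)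
    exact (tendsto_atTop_add_const_right atTop (-r) tendsto_id).const_mul_atTop two_pos
  have h := integral_of_hasDerivAt_of_tendsto (fun s => (hf s).mul (hs s)) (i2.add i1)
    (hg.tendsto_mul_sigmoid r) (hT.mul hT2)
  rw [integral_add i2 i1, zero_mul, sub_zero] at h
  rw [e1, stieltjes]
  linear_combination h

lemma stieltjes_exp_two_mul {f : ℝ → ℂ} (hf : SuperDecay f) (hc : Continuous f) (r : ℝ) :
    stieltjes (fun s : ℝ => Complex.exp (2 * s) * f s) r =
      (∫ s : ℝ, Complex.exp (2 * s) * f s) - Complex.exp (2 * r) * stieltjes f r := by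
  rw [stieltjes, stieltjes, ← integral_const_mul, ← integral_sub (hf.integrable_exp_two_mul hc)
    ((hf.expDecay.integrable_sigmoid hc r).const_mul _)]
  congr 1 with s
  have h : Real.exp (2 * s) * Real.sigmoid (2 * (s - r)) =
      Real.exp (2 * s) - Real.exp (2 * r) * Real.sigmoid (2 * (s - r)) := by
    have h1 := Real.sigmoid_mul_rexp_neg (2 * (s - r))
    rw [Real.sigmoid_neg] at h1
    have h2 : Real.exp (2 * r) = Real.exp (2 * s) * Real.exp (-(2 * (s - r))) := by
      rw [← Real.exp_add]; congr 1; ring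
    rw [h2]
    linear_combination Real.exp (2 * s) * h1
  have h' := congrArg (fun x : ℝ => (x : ℂ)) h
  push_cast at h'
  linear_combination f s * h'

lemma stieltjes_add {f g : ℝ → ℂ} (hf : ExpDecay f) (hcf : Continuous f) (hg : ExpDecay g)
    (hcg : Continuous g) (r : ℝ) :
    stieltjes (fun s => f s + g s) r = stieltjes f r + stieltjes g r := by
  rw [stieltjes, stieltjes, stieltjes,
    ← integral_add (hf.integrable_sigmoid hcf r) (hg.integrable_sigmoid hcg r)]
  simp only [add_mul]

lemma stieltjes_const_mul (c : ℂ) (f : ℝ → ℂ) (r : ℝ) :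
    stieltjes (fun s => c * f s) r = c * stieltjes f r := by
  rw [stieltjes, stieltjes, ← integral_const_mul]
  simp only [mul_assoc]

/-! ### The square of the Macdonald function and its antiderivative -/

lemma tendsto_sub_linExp {ν : ℂ} (hν : ν.re = 0) {f P Q S T : ℝ → ℂ} {α c β γ : ℂ}
    (hP : FastLim P α) (hQ : FastLim Q c) (hS : FastLim S β) (hT : FastLim T γ)
    (hf : ∀ r : ℝ, f r = r * P r + Q r + Complex.exp (ν * r) ^ 2 * S r +
      Complex.exp (-ν * r) ^ 2 * T r) :
    Tendsto (fun r => f r - linExp ν α c β γ r) atBot (𝓝 0) := by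
  have h := ((hP.tendsto_id_mul.add hQ.tendsto_sub).add
    (hS.tendsto_exp_mul (lam := 2 * ν) (by simp [hν]))).add
    (hT.tendsto_exp_mul (lam := -(2 * ν)) (by simp [hν]))
  simp only [add_zero] at h
  refine h.congr fun r => ?_
  have h1 : Complex.exp (2 * ν * r) = Complex.exp (ν * r) ^ 2 := by
    rw [← Complex.exp_nat_mul]; congr 1; push_cast; ring
  have h2 : Complex.exp (-(2 * ν) * r) = Complex.exp (-ν * r) ^ 2 := by
    rw [← Complex.exp_nat_mul]; congr 1; push_cast; ring
  rw [hf, linExp, h1, h2]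
  ring

lemma linGrowth_of_norm_le {f : ℝ → ℂ} {C : ℝ} (h : ∀ s, ‖f s‖ ≤ C) : LinGrowth f := by
  have h0 : 0 ≤ C := (norm_nonneg _).trans (h 0)
  exact ⟨C, h0, fun s => (h s).trans (le_mul_of_one_le_right h0 (by linarith [abs_nonneg s]))⟩

section

variable {ν : ℂ}

lemma superDecay_macInt {j : ℕ} (hj : j ≤ 1) (hν : ν.re = 0) : SuperDecay (macInt j (1 + ν)) := by
  obtain ⟨C, h0, hC⟩ := norm_macInt_le (μ := 1 + ν) hj (by simp [hν])
  have hc : Continuous (macInt j (1 + ν)) :=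
    continuous_iff_continuousAt.2 fun s => (hasDerivAt_macInt_one_add hj hν s).continuousAt
  obtain ⟨D, h1, hD⟩ := exists_norm_le_Iic hc (fastLim_macInt hj (by simp [hν])).tendsto
  refine ⟨C + D * Real.exp 1, by positivity, fun s => ?_⟩
  rw [add_mul]
  rcases le_total 0 s with h | h
  · exact (hC s h).trans (le_add_of_nonneg_right (by positivity))
  · refine (hD s h).trans (le_add_of_nonneg_of_le (by positivity) ?_)
    rw [mul_assoc, ← Real.exp_add]
    exact le_mul_of_one_le_right h1 (Real.one_le_exp (by linarith [Real.exp_le_one_iff.2 h]))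

lemma superDecay_macInt_sub {j : ℕ} (hj : j ≤ 1) (hν : ν.re = 0) :
    SuperDecay (macInt j (1 - ν)) := by
  simpa [sub_eq_add_neg] using superDecay_macInt (ν := -ν) hj (by simp [hν])

lemma SuperDecay.cexp_mul {f : ℝ → ℂ} (hf : SuperDecay f) {lam : ℂ} (h : lam.re = 0) :
    SuperDecay fun s : ℝ => Complex.exp (lam * s) * f s :=
  hf.bounded_mul fun s => (norm_cexp_mul_ofReal h s).le

lemma superDecay_macK (hν : ν.re = 0) : SuperDecay (macK ν) := by
  have h := (((superDecay_macInt zero_le_one hν).cexp_mul (lam := -ν) (by simp [hν])).add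
    (((superDecay_macInt_sub zero_le_one hν).cexp_mul hν).const_mul (-1))).const_mul (2 * ν)⁻¹
  refine (funext fun s => ?_ : macK ν = _) ▸ h
  rw [macK]
  ring

lemma superDecay_macK' (hν : ν.re = 0) : SuperDecay (macK' ν) := by
  have h := (((superDecay_macInt zero_le_one hν).cexp_mul (lam := -ν) (by simp [hν])).add
    ((superDecay_macInt_sub zero_le_one hν).cexp_mul hν)).const_mul (-1 / 2)
  refine (funext fun s => ?_ : macK' ν = _) ▸ h
  rw [macK']
  ring

/-- An antiderivative of `macK ν ^ 2` vanishing at `+∞`. -/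
noncomputable def macU (ν : ℂ) (r : ℝ) : ℂ :=
  (macInt 0 (1 - ν) r * macInt 1 (1 + ν) r + macInt 0 (1 + ν) r * macInt 1 (1 - ν) r -
    2 * (r * (macInt 0 (1 + ν) r * macInt 0 (1 - ν) r))) / (4 * ν ^ 2) -
  ((Complex.exp (-ν * r) * macInt 0 (1 + ν) r) ^ 2 -
    (Complex.exp (ν * r) * macInt 0 (1 - ν) r) ^ 2) / (8 * ν ^ 3)

lemma macU_deriv_algebra {ν A a B b E F κ l w r K : ℂ} (h0 : ν ≠ 0) (e : E * F = 1)
    (h1 : ν * κ = A - E ^ 2 * a) (h2 : κ + ν * l = B - E ^ 2 * (2 * r * a - b))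
    (h3 : F * κ = 2 * K) :
    ((-2 * w * (F ^ 2 * κ) * B + a * (-2 * w * l) + (-2 * w * κ * b +
      A * (-2 * w * (F ^ 2 * (2 * r * κ - l)))) - 2 * (1 * (A * a) + r * (-2 * w * κ * a +
        A * (-2 * w * (F ^ 2 * κ)))))) / (4 * ν ^ 2) -
    (2 * (F * A) * (-ν * F * A + F * (-2 * w * κ)) -
      2 * (E * a) * (ν * E * a + E * (-2 * w * (F ^ 2 * κ)))) / (8 * ν ^ 3) = K ^ 2 := by
  obtain rfl : A = ν * κ + E ^ 2 * a := by linear_combination -h1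
  obtain rfl : B = κ + ν * l + E ^ 2 * (2 * r * a - b) := by linear_combination -h2
  obtain rfl : K = F * κ / 2 := by linear_combination -h3 / 2
  have hE : E ≠ 0 := left_ne_zero_of_mul_eq_one e
  obtain rfl : F = E⁻¹ := eq_inv_of_mul_eq_one_right e
  field_simp
  ring

lemma hasDerivAt_macU (hν : ν.re = 0) (h0 : ν ≠ 0) (r : ℝ) :
    HasDerivAt (macU ν) (macK ν r ^ 2) r := by
  have hA := hasDerivAt_macInt_one_add zero_le_one hν r
  have hB := hasDerivAt_macInt_one_add le_rfl hν r
  have ha := hasDerivAt_macInt_zero_one_sub hν r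
  have hb := hasDerivAt_macInt_one_one_sub hν r
  have hr : HasDerivAt (fun r : ℝ => (r : ℂ)) 1 r := (hasDerivAt_id r).ofReal_comp
  have h := ((((ha.mul hB).add (hA.mul hb)).sub ((hr.mul (hA.mul ha)).const_mul 2)).div_const
    (4 * ν ^ 2)).sub (((((hasDerivAt_cexp_mul (-ν) r).mul hA).pow 2).sub
      (((hasDerivAt_cexp_mul ν r).mul ha).pow 2)).div_const (8 * ν ^ 3))
  refine h.congr_deriv ?_
  rw [← macU_deriv_algebra (w := Complex.exp (2 * r)) h0 (cexp_mul_cexp_neg ν r)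
    (macInt_zero_relation hν r) (macInt_one_relation hν r) (cexp_mul_macInt_zero hν h0 r)]
  simp only [Pi.mul_apply]
  push_cast
  ring

lemma continuous_macK (hν : ν.re = 0) (h0 : ν ≠ 0) : Continuous (macK ν) :=
  continuous_iff_continuousAt.2 fun s => (hasDerivAt_macK hν h0 s).continuousAt

lemma continuous_macU (hν : ν.re = 0) (h0 : ν ≠ 0) : Continuous (macU ν) :=
  continuous_iff_continuousAt.2 fun s => (hasDerivAt_macU hν h0 s).continuousAt

/-- The derivative of `macK ν ^ 2`. -/
noncomputable def macSq' (ν : ℂ) (r : ℝ) : ℂ := 2 * (macK ν r * macK' ν r)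

/-- The second derivative of `macK ν ^ 2`, minus `4 ν ^ 2 * macK ν ^ 2`. -/
noncomputable def macV (ν : ℂ) (r : ℝ) : ℂ :=
  2 * macK' ν r ^ 2 + (8 * Complex.exp (2 * r) - 2 * ν ^ 2) * macK ν r ^ 2

lemma hasDerivAt_macK_sq (hν : ν.re = 0) (h0 : ν ≠ 0) (r : ℝ) :
    HasDerivAt (fun r => macK ν r ^ 2) (macSq' ν r) r := by
  refine ((hasDerivAt_macK hν h0 r).pow 2).congr_deriv ?_
  rw [macSq']
  push_cast
  ring

lemma hasDerivAt_macSq' (hν : ν.re = 0) (h0 : ν ≠ 0) (r : ℝ) :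
    HasDerivAt (macSq' ν) (macV ν r + 4 * ν ^ 2 * macK ν r ^ 2) r := by
  refine (((hasDerivAt_macK hν h0 r).mul (hasDerivAt_macK' hν h0 r)).const_mul 2).congr_deriv ?_
  rw [macV]
  ring

lemma hasDerivAt_macV (hν : ν.re = 0) (h0 : ν ≠ 0) (r : ℝ) :
    HasDerivAt (macV ν)
      (Complex.exp (2 * r) * (16 * (macK ν r ^ 2 + macSq' ν r))) r := by
  have h := (((hasDerivAt_macK' hν h0 r).pow 2).const_mul 2).add
    ((((hasDerivAt_cexp_mul 2 r).const_mul 8).sub_const (2 * ν ^ 2)).mul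
      (hasDerivAt_macK_sq hν h0 r))
  refine h.congr_deriv ?_
  rw [macSq']
  push_cast
  ring

lemma continuous_macSq' (hν : ν.re = 0) (h0 : ν ≠ 0) : Continuous (macSq' ν) :=
  continuous_iff_continuousAt.2 fun s => (hasDerivAt_macSq' hν h0 s).continuousAt

lemma continuous_macV (hν : ν.re = 0) (h0 : ν ≠ 0) : Continuous (macV ν) :=
  continuous_iff_continuousAt.2 fun s => (hasDerivAt_macV hν h0 s).continuousAt

lemma superDecay_macK_sq (hν : ν.re = 0) : SuperDecay fun r => macK ν r ^ 2 := by
  simpa only [pow_two] using (superDecay_macK hν).mul (superDecay_macK hν)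

lemma superDecay_macSq' (hν : ν.re = 0) : SuperDecay (macSq' ν) :=
  ((superDecay_macK hν).mul (superDecay_macK' hν)).const_mul 2

lemma tendsto_macU_atTop (hν : ν.re = 0) : Tendsto (macU ν) atTop (𝓝 0) := by
  have hA := superDecay_macInt zero_le_one hν
  have hB := superDecay_macInt le_rfl hν
  have ha := superDecay_macInt_sub zero_le_one hν
  have hb := superDecay_macInt_sub le_rfl hν
  have hE := ha.cexp_mul hν
  have hF := hA.cexp_mul (lam := -ν) (by simp [hν])
  have h := ((((ha.mul hB).add (hA.mul hb)).tendsto.sub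
    ((hA.mul ha).tendsto_id_mul.const_mul 2)).div_const (4 * ν ^ 2)).sub
      (((hF.tendsto.pow 2).sub (hE.tendsto.pow 2)).div_const (8 * ν ^ 3))
  refine Tendsto.congr (fun r => (macU.eq_1 ν r).symm) ?_
  simpa only [mul_zero, sub_zero, zero_div, ne_eq, OfNat.ofNat_ne_zero, not_false_eq_true,
    zero_pow] using h

lemma macV_eq (h0 : ν ≠ 0) (r : ℝ) : macV ν r =
    2 * (macInt 0 (1 + ν) r * macInt 0 (1 - ν) r) +
      8 * (Complex.exp (2 * r) * macK ν r ^ 2) := by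
  rw [macV, macK', macK]
  have e := cexp_mul_cexp_neg ν r
  generalize Complex.exp (ν * r) = E, Complex.exp (-ν * r) = F at *
  field_simp
  linear_combination 8 * ν ^ 2 * macInt 0 (1 + ν) r * macInt 0 (1 - ν) r * e

lemma tendsto_exp_two_mul_atTop {f : ℝ → ℂ} (hf : SuperDecay f) :
    Tendsto (fun s : ℝ => Complex.exp (2 * s) * f s) atTop (𝓝 0) := by
  obtain ⟨C, -, hC⟩ := hf.exp_two_mul_bounds
  refine squeeze_zero_norm (fun s => (hC s).2.1) ?_
  simpa using Real.tendsto_exp_neg_atTop_nhds_zero.const_mul C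

lemma tendsto_exp_two_mul_atBot {f : ℝ → ℂ} (hf : SuperDecay f) :
    Tendsto (fun s : ℝ => Complex.exp (2 * s) * f s) atBot (𝓝 0) := by
  obtain ⟨C, -, hC⟩ := hf.exp_two_mul_bounds
  refine squeeze_zero_norm (fun s => (hC s).2.2) ?_
  simpa using (Real.tendsto_exp_atBot.comp (tendsto_id.const_mul_atBot two_pos)).const_mul C

lemma fastLim_gamma_sub (hν : ν.re = 0) :
    FastLim (macInt 0 (1 - ν)) (Complex.Gamma (1 - ν)) := by
  simpa [sub_eq_add_neg] using fastLim_gamma (ν := -ν) (by simp [hν])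

lemma tendsto_macV_atTop (hν : ν.re = 0) (h0 : ν ≠ 0) : Tendsto (macV ν) atTop (𝓝 0) := by
  have h := (((superDecay_macInt zero_le_one hν).mul
    (superDecay_macInt_sub zero_le_one hν)).tendsto.const_mul 2).add
      ((tendsto_exp_two_mul_atTop (superDecay_macK_sq hν)).const_mul 8)
  rw [funext (macV_eq h0)]
  simpa using h

lemma tendsto_macV_atBot (hν : ν.re = 0) (h0 : ν ≠ 0) :
    Tendsto (macV ν) atBot (𝓝 (2 * (Complex.Gamma (1 + ν) * Complex.Gamma (1 - ν)))) := by
  have h := (((fastLim_gamma hν).mul (fastLim_gamma_sub hν)).tendsto.const_mul 2).add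
      ((tendsto_exp_two_mul_atBot (superDecay_macK_sq hν)).const_mul 8)
  rw [funext (macV_eq h0)]
  simpa using h

lemma exists_norm_macV_le (hν : ν.re = 0) (h0 : ν ≠ 0) : ∃ C, ∀ s, ‖macV ν s‖ ≤ C := by
  obtain ⟨C, h1, hC⟩ := exists_norm_le_Iic (continuous_macV hν h0) (tendsto_macV_atBot hν h0)
  obtain ⟨D, h2, hD⟩ := exists_norm_le_Ici (continuous_macV hν h0) (tendsto_macV_atTop hν h0)
  refine ⟨C + D, fun s => ?_⟩
  rcases le_total s 0 with h | h
  · linarith [hC s h]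
  · linarith [hD s h]

lemma tendsto_macU_sub (hν : ν.re = 0) : Tendsto (fun r => macU ν r - linExp ν
    (-(Complex.Gamma (1 + ν) * Complex.Gamma (1 - ν)) / (2 * ν ^ 2))
    ((Complex.Gamma (1 - ν) * gammaLog 1 (1 + ν) + Complex.Gamma (1 + ν) * gammaLog 1 (1 - ν)) /
      (4 * ν ^ 2)) (Complex.Gamma (1 - ν) ^ 2 / (8 * ν ^ 3))
    (-Complex.Gamma (1 + ν) ^ 2 / (8 * ν ^ 3)) r) atBot (𝓝 0) := by
  have hA := fastLim_gamma hν
  have ha := fastLim_gamma_sub hν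
  have hB := fastLim_macInt (μ := 1 + ν) le_rfl (by simp [hν])
  have hb := fastLim_macInt (μ := 1 - ν) le_rfl (by simp [hν])
  have h := tendsto_sub_linExp (f := macU ν) hν ((hA.mul ha).const_mul (-1 / (2 * ν ^ 2)))
    (((ha.mul hB).add (hA.mul hb)).const_mul (1 / (4 * ν ^ 2)))
    ((ha.mul ha).const_mul (1 / (8 * ν ^ 3))) ((hA.mul hA).const_mul (-1 / (8 * ν ^ 3)))
    fun r => by rw [macU]; ring
  convert h using 4 <;> ring

lemma tendsto_macK_sq_sub (hν : ν.re = 0) : Tendsto (fun r => macK ν r ^ 2 - linExp ν 0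
    (-(Complex.Gamma (1 + ν) * Complex.Gamma (1 - ν)) / (2 * ν ^ 2))
    (Complex.Gamma (1 - ν) ^ 2 / (4 * ν ^ 2)) (Complex.Gamma (1 + ν) ^ 2 / (4 * ν ^ 2)) r)
    atBot (𝓝 0) := by
  have hA := fastLim_gamma hν
  have ha := fastLim_gamma_sub hν
  have h := tendsto_sub_linExp (f := fun r => macK ν r ^ 2) hν (FastLim.const 0)
    ((hA.mul ha).const_mul (-1 / (2 * ν ^ 2)))
    ((ha.mul ha).const_mul (1 / (4 * ν ^ 2))) ((hA.mul hA).const_mul (1 / (4 * ν ^ 2)))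
    fun r => by
      rw [macK]
      linear_combination (-macInt 0 (1 + ν) r * macInt 0 (1 - ν) r / (2 * ν ^ 2)) *
        cexp_mul_cexp_neg ν r
  convert h using 4 <;> ring

lemma tendsto_macSq'_sub (hν : ν.re = 0) : Tendsto (fun r => macSq' ν r - linExp ν 0 0
    (Complex.Gamma (1 - ν) ^ 2 / (2 * ν)) (-Complex.Gamma (1 + ν) ^ 2 / (2 * ν)) r)
    atBot (𝓝 0) := by
  have hA := fastLim_gamma hν
  have ha := fastLim_gamma_sub hν
  have h := tendsto_sub_linExp (f := macSq' ν) hν (FastLim.const 0) (FastLim.const 0)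
    ((ha.mul ha).const_mul (1 / (2 * ν))) ((hA.mul hA).const_mul (-1 / (2 * ν)))
    fun r => by rw [macSq', macK, macK']; ring
  convert h using 4 <;> ring

/-! ### The Stieltjes transform of the squared Macdonald function -/

/-- The Stieltjes transform of `y ↦ K_ν(√y)²` in logarithmic variables. -/
noncomputable def macF (ν : ℂ) (r : ℝ) : ℂ := -2 * smooth (macU ν) r

lemma macF_eq_stieltjes (hν : ν.re = 0) (h0 : ν ≠ 0) (r : ℝ) :
    macF ν r = 2 * stieltjes (fun s => macK ν s ^ 2) r := by
  rw [macF, smooth_eq_neg_stieltjes (hasDerivAt_macU hν h0)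
    (linGrowth_of_tendsto hν (continuous_macU hν h0) (tendsto_macU_atTop hν) (tendsto_macU_sub hν))
    (tendsto_macU_atTop hν) ((continuous_macK hν h0).pow 2) (superDecay_macK_sq hν).expDecay]
  ring

lemma hasDerivAt_macF (hν : ν.re = 0) (h0 : ν ≠ 0) (r : ℝ) :
    HasDerivAt (macF ν) (-2 * smooth (fun s => macK ν s ^ 2) r) r := by
  obtain ⟨C, hC⟩ := (superDecay_macK_sq hν).bounded
  exact (hasDerivAt_smooth (hasDerivAt_macU hν h0) (linGrowth_of_tendsto hν (continuous_macU hν h0)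
    (tendsto_macU_atTop hν) (tendsto_macU_sub hν)) ((continuous_macK hν h0).pow 2) hC r).const_mul _

lemma hasDerivAt_smooth_macK_sq (hν : ν.re = 0) (h0 : ν ≠ 0) (r : ℝ) :
    HasDerivAt (smooth fun s => macK ν s ^ 2) (smooth (macSq' ν) r) r := by
  obtain ⟨C, hC⟩ := (superDecay_macK_sq hν).bounded
  obtain ⟨D, hD⟩ := (superDecay_macSq' hν).bounded
  exact hasDerivAt_smooth (hasDerivAt_macK_sq hν h0) (linGrowth_of_norm_le hC)
    (continuous_macSq' hν h0) hD r

lemma smooth_add {f g : ℝ → ℂ} (hf : LinGrowth f) (hcf : Continuous f) (hg : LinGrowth g)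
    (hcg : Continuous g) (r : ℝ) : smooth (fun s => f s + g s) r = smooth f r + smooth g r := by
  rw [smooth, smooth, smooth, ← integral_add (hf.integrable hcf r) (hg.integrable hcg r)]
  simp only [add_mul]

lemma smooth_const_mul (c : ℂ) (f : ℝ → ℂ) (r : ℝ) :
    smooth (fun s => c * f s) r = c * smooth f r := by
  rw [smooth, smooth, ← integral_const_mul]
  simp only [mul_assoc]

lemma smooth_macV (hν : ν.re = 0) (h0 : ν ≠ 0) (r : ℝ) : smooth (macV ν) r =
    2 * (Complex.Gamma (1 + ν) * Complex.Gamma (1 - ν)) +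
      4 * Complex.exp (2 * r) * (macF ν r + -2 * smooth (fun s => macK ν s ^ 2) r) * 2 := by
  obtain ⟨C, hC⟩ := exists_norm_macV_le hν h0
  obtain ⟨D, hD⟩ := (superDecay_macK_sq hν).bounded
  have hu := superDecay_macK_sq hν
  have hcu := (continuous_macK hν h0).pow 2
  have hu1 := superDecay_macSq' hν
  have hcu1 := continuous_macSq' hν h0
  have hs : SuperDecay fun s => 16 * (macK ν s ^ 2 + macSq' ν s) := (hu.add hu1).const_mul 16
  have hcs : Continuous fun s => 16 * (macK ν s ^ 2 + macSq' ν s) :=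
    continuous_const.mul (hcu.add hcu1)
  have hce : Continuous fun s : ℝ => Complex.exp (2 * s) := by fun_prop
  have hd := hasDerivAt_macV hν h0
  have hi := integral_of_hasDerivAt_of_tendsto hd (hs.integrable_exp_two_mul hcs)
    (tendsto_macV_atBot hν h0) (tendsto_macV_atTop hν h0)
  have hsm := smooth_eq_neg_stieltjes (hasDerivAt_macK_sq hν h0) (linGrowth_of_norm_le hD)
    hu.tendsto hcu1 hu1.expDecay r
  rw [smooth_eq_neg_stieltjes hd (linGrowth_of_norm_le hC) (tendsto_macV_atTop hν h0)
    (hce.mul hcs) hs.exp_two_mul, stieltjes_exp_two_mul hs hcs, hi, stieltjes_const_mul,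
    stieltjes_add hu.expDecay hcu hu1.expDecay hcu1, macF_eq_stieltjes hν h0, hsm]
  ring

lemma hasDerivAt_smooth_macSq' (hν : ν.re = 0) (h0 : ν ≠ 0) (r : ℝ) :
    HasDerivAt (smooth (macSq' ν)) (smooth (macV ν) r +
      4 * ν ^ 2 * smooth (fun s => macK ν s ^ 2) r) r := by
  obtain ⟨C, hC⟩ := exists_norm_macV_le hν h0
  obtain ⟨D, hD⟩ := ((superDecay_macK_sq hν).const_mul (4 * ν ^ 2)).bounded
  obtain ⟨C', hC'⟩ := (superDecay_macSq' hν).bounded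
  have hcv := continuous_macV hν h0
  have hcu : Continuous fun s => 4 * ν ^ 2 * macK ν s ^ 2 :=
    continuous_const.mul ((continuous_macK hν h0).pow 2)
  rw [← smooth_const_mul, ← smooth_add (linGrowth_of_norm_le hC) hcv (linGrowth_of_norm_le hD) hcu]
  exact hasDerivAt_smooth (hasDerivAt_macSq' hν h0) (linGrowth_of_norm_le hC') (hcv.add hcu)
    (fun s => (norm_add_le _ _).trans (add_le_add (hC s) (hD s))) r

end

/-! ### The Bessel side -/

section

variable {ν : ℂ}

/-- The regular factor of `J_ν` in logarithmic variables. -/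
noncomputable def serJ (ν : ℂ) : ℝ → ℂ := expSeries (besselCoeff (-1) ν)

/-- The derivative of `serJ`. -/
noncomputable def serJ' (ν : ℂ) : ℝ → ℂ := expSeries fun k => 2 * k * besselCoeff (-1) ν k

/-- The derivative of `serJ` with respect to the order. -/
noncomputable def serM (ν : ℂ) : ℝ → ℂ := expSeries (besselCoeffDeriv (-1) ν)

/-- The derivative of `serM`. -/
noncomputable def serM' (ν : ℂ) : ℝ → ℂ := expSeries fun k => 2 * k * besselCoeffDeriv (-1) ν k

lemma norm_neg_one_le : ‖(-1 : ℂ)‖ ≤ 1 := by simp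

lemma hasDerivAt_serJ (hν : ν.re = 0) (r : ℝ) : HasDerivAt (serJ ν) (serJ' ν r) r :=
  (entireCoeff_besselCoeff norm_neg_one_le hν).hasDerivAt r

lemma hasDerivAt_serJ' (hν : ν.re = 0) (r : ℝ) : HasDerivAt (serJ' ν)
    (-(2 * ν) * serJ' ν r - 4 * Complex.exp (2 * r) * serJ ν r) r := by
  refine ((entireCoeff_besselCoeff norm_neg_one_le hν).mul_index.hasDerivAt r).congr_deriv ?_
  rw [expSeries_besselCoeff_ode norm_neg_one_le hν, serJ', serJ]
  ring

lemma hasDerivAt_serM (hν : ν.re = 0) (r : ℝ) : HasDerivAt (serM ν) (serM' ν r) r :=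
  (entireCoeff_besselCoeffDeriv norm_neg_one_le hν).hasDerivAt r

lemma hasDerivAt_serM' (hν : ν.re = 0) (r : ℝ) : HasDerivAt (serM' ν)
    (-(2 * ν) * serM' ν r - 2 * serJ' ν r - 4 * Complex.exp (2 * r) * serM ν r) r := by
  refine ((entireCoeff_besselCoeffDeriv norm_neg_one_le hν).mul_index.hasDerivAt r).congr_deriv ?_
  rw [expSeries_besselCoeffDeriv_ode norm_neg_one_le hν, serJ', serM', serM]
  ring

lemma fastLim_serJ (hν : ν.re = 0) : FastLim (serJ ν) (Complex.Gamma (1 + ν))⁻¹ :=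
  fastLim_besselCoeff norm_neg_one_le hν

lemma fastLim_serJ' (hν : ν.re = 0) : FastLim (serJ' ν) 0 :=
  fastLim_mul_index (entireCoeff_besselCoeff norm_neg_one_le hν)

lemma fastLim_serM' (hν : ν.re = 0) : FastLim (serM' ν) 0 :=
  fastLim_mul_index (entireCoeff_besselCoeffDeriv norm_neg_one_le hν)

lemma fastLim_serM (hν : ν.re = 0) :
    FastLim (serM ν) (-gammaLog 1 (1 + ν) / Complex.Gamma (1 + ν) ^ 2) := by
  have h := (entireCoeff_besselCoeffDeriv norm_neg_one_le hν).fastLim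
  have hre : (1 + ν).re = 1 := by simp [hν]
  have hd : HasDerivAt (fun μ => besselCoeff (-1) μ 0)
      (-gammaLog 1 (1 + ν) / Complex.Gamma (1 + ν) ^ 2) ν := by
    have h1 := ((hasDerivAt_Gamma hre).comp_const_add 1 ν).fun_inv
      (Gamma_ne_zero_of_re_eq_one hre)
    simpa [besselCoeff, add_comm] using h1
  rwa [besselCoeffDeriv, hd.deriv] at h

/-- `J_ν` in logarithmic variables. -/
noncomputable def logJ (ν : ℂ) (r : ℝ) : ℂ := Complex.exp (ν * r) * serJ ν r

/-- The derivative of `logJ`. -/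
noncomputable def logJ' (ν : ℂ) (r : ℝ) : ℂ :=
  Complex.exp (ν * r) * (ν * serJ ν r + serJ' ν r)

/-- The derivative of `logJ` with respect to the order. -/
noncomputable def logM (ν : ℂ) (r : ℝ) : ℂ :=
  Complex.exp (ν * r) * (r * serJ ν r + serM ν r)

/-- The derivative of `logM`. -/
noncomputable def logM' (ν : ℂ) (r : ℝ) : ℂ :=
  Complex.exp (ν * r) * (ν * (r * serJ ν r + serM ν r) + serJ ν r + r * serJ' ν r + serM' ν r)

lemma hasDerivAt_logJ (hν : ν.re = 0) (r : ℝ) : HasDerivAt (logJ ν) (logJ' ν r) r := by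
  refine ((hasDerivAt_cexp_mul ν r).mul (hasDerivAt_serJ hν r)).congr_deriv ?_
  rw [logJ']
  ring

lemma hasDerivAt_logJ' (hν : ν.re = 0) (r : ℝ) :
    HasDerivAt (logJ' ν) ((ν ^ 2 - 4 * Complex.exp (2 * r)) * logJ ν r) r := by
  refine ((hasDerivAt_cexp_mul ν r).mul (((hasDerivAt_serJ hν r).const_mul ν).add
    (hasDerivAt_serJ' hν r))).congr_deriv ?_
  rw [logJ]
  simp only [Pi.add_apply]
  ring

lemma hasDerivAt_logM (hν : ν.re = 0) (r : ℝ) : HasDerivAt (logM ν) (logM' ν r) r := by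
  have hr : HasDerivAt (fun r : ℝ => (r : ℂ)) 1 r := (hasDerivAt_id r).ofReal_comp
  refine ((hasDerivAt_cexp_mul ν r).mul ((hr.mul (hasDerivAt_serJ hν r)).add
    (hasDerivAt_serM hν r))).congr_deriv ?_
  rw [logM']
  simp only [Pi.add_apply, Pi.mul_apply]
  ring

lemma hasDerivAt_logM' (hν : ν.re = 0) (r : ℝ) : HasDerivAt (logM' ν)
    ((ν ^ 2 - 4 * Complex.exp (2 * r)) * logM ν r + 2 * ν * logJ ν r) r := by
  have hr : HasDerivAt (fun r : ℝ => (r : ℂ)) 1 r := (hasDerivAt_id r).ofReal_comp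
  have hj := hasDerivAt_serJ hν r
  refine ((hasDerivAt_cexp_mul ν r).mul ((((((hr.mul hj).add
    (hasDerivAt_serM hν r)).const_mul ν).add hj).add (hr.mul (hasDerivAt_serJ' hν r))).add
      (hasDerivAt_serM' hν r))).congr_deriv ?_
  rw [logJ, logM]
  simp only [Pi.add_apply, Pi.mul_apply]
  ring

lemma wronskian_logJ (hν : ν.re = 0) (r : ℝ) :
    logJ ν r * logJ' (-ν) r - logJ' ν r * logJ (-ν) r =
      -(2 * ν) * ((Complex.Gamma (1 + ν))⁻¹ * (Complex.Gamma (1 - ν))⁻¹) := by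
  have hν' : (-ν).re = 0 := by simp [hν]
  set W : ℝ → ℂ := fun r => logJ ν r * logJ' (-ν) r - logJ' ν r * logJ (-ν) r
  have hW : ∀ r, HasDerivAt W 0 r := fun r => by
    refine (((hasDerivAt_logJ hν r).mul (hasDerivAt_logJ' hν' r)).sub
      ((hasDerivAt_logJ' hν r).mul (hasDerivAt_logJ hν' r))).congr_deriv ?_
    ring
  have hc : W = fun _ => W r := funext fun s =>
    is_const_of_deriv_eq_zero (fun s => (hW s).differentiableAt) (fun s => (hW s).deriv) s r
  have hj := fastLim_serJ hν
  have hj' := fastLim_serJ hν'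
  have h := (((hj.mul hj').const_mul (-(2 * ν))).add ((hj.mul (fastLim_serJ' hν')).sub
    ((fastLim_serJ' hν).mul hj'))).tendsto
  have h1 : Tendsto W atBot (𝓝 _) := h.congr fun r => by
    simp only [W, logJ, logJ']
    linear_combination (2 * ν * (serJ ν r * serJ (-ν) r) - (serJ ν r * serJ' (-ν) r -
      serJ' ν r * serJ (-ν) r)) * cexp_mul_cexp_neg ν r
  rw [hc] at h1
  refine (tendsto_nhds_unique tendsto_const_nhds h1).trans ?_
  rw [← sub_eq_add_neg]
  ring

/-- The symmetrised order derivative. -/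
noncomputable def logZ (ν : ℂ) (r : ℝ) : ℂ := logJ ν r * logM (-ν) r + logJ (-ν) r * logM ν r

/-- The derivative of `logZ`. -/
noncomputable def logZ' (ν : ℂ) (r : ℝ) : ℂ :=
  logJ' ν r * logM (-ν) r + logJ ν r * logM' (-ν) r +
    (logJ' (-ν) r * logM ν r + logJ (-ν) r * logM' ν r)

/-- The second derivative of `logZ`. -/
noncomputable def logZ'' (ν : ℂ) (r : ℝ) : ℂ :=
  2 * (ν ^ 2 - 4 * Complex.exp (2 * r)) * logZ ν r +
    2 * (logJ' ν r * logM' (-ν) r + logJ' (-ν) r * logM' ν r)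

lemma hasDerivAt_logZ (hν : ν.re = 0) (r : ℝ) : HasDerivAt (logZ ν) (logZ' ν r) r := by
  have hν' : (-ν).re = 0 := by simp [hν]
  exact ((hasDerivAt_logJ hν r).mul (hasDerivAt_logM hν' r)).add
    ((hasDerivAt_logJ hν' r).mul (hasDerivAt_logM hν r))

lemma hasDerivAt_logZ' (hν : ν.re = 0) (r : ℝ) : HasDerivAt (logZ' ν) (logZ'' ν r) r := by
  have hν' : (-ν).re = 0 := by simp [hν]
  refine ((((hasDerivAt_logJ' hν r).mul (hasDerivAt_logM hν' r)).add
    ((hasDerivAt_logJ hν r).mul (hasDerivAt_logM' hν' r))).add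
    (((hasDerivAt_logJ' hν' r).mul (hasDerivAt_logM hν r)).add
    ((hasDerivAt_logJ hν' r).mul (hasDerivAt_logM' hν r)))).congr_deriv ?_
  rw [logZ'', logZ]
  ring

lemma hasDerivAt_logZ'' (hν : ν.re = 0) (r : ℝ) : HasDerivAt (logZ'' ν)
    (4 * ν ^ 2 * logZ' ν r - 16 * Complex.exp (2 * r) * (logZ' ν r + logZ ν r) -
      8 * ν ^ 2 * ((Complex.Gamma (1 + ν))⁻¹ * (Complex.Gamma (1 - ν))⁻¹)) r := by
  have hν' : (-ν).re = 0 := by simp [hν]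
  refine (((((hasDerivAt_cexp_mul 2 r).const_mul 4).const_sub (ν ^ 2)).const_mul 2).mul
    (hasDerivAt_logZ hν r) |>.add ((((hasDerivAt_logJ' hν r).mul (hasDerivAt_logM' hν' r)).add
    ((hasDerivAt_logJ' hν' r).mul (hasDerivAt_logM' hν r))).const_mul 2)).congr_deriv ?_
  rw [logZ', logZ]
  linear_combination 4 * ν * wronskian_logJ hν r

/-- The square of `logJ`, antisymmetrised in the order. -/
noncomputable def logS (ν : ℂ) (r : ℝ) : ℂ := logJ ν r ^ 2 - logJ (-ν) r ^ 2

/-- The derivative of `logS`. -/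
noncomputable def logS' (ν : ℂ) (r : ℝ) : ℂ :=
  2 * (logJ ν r * logJ' ν r - logJ (-ν) r * logJ' (-ν) r)

/-- The second derivative of `logS`. -/
noncomputable def logS'' (ν : ℂ) (r : ℝ) : ℂ :=
  2 * (logJ' ν r ^ 2 - logJ' (-ν) r ^ 2) +
    2 * (ν ^ 2 - 4 * Complex.exp (2 * r)) * logS ν r

lemma hasDerivAt_logS (hν : ν.re = 0) (r : ℝ) : HasDerivAt (logS ν) (logS' ν r) r := by
  have hν' : (-ν).re = 0 := by simp [hν]
  refine (((hasDerivAt_logJ hν r).pow 2).sub ((hasDerivAt_logJ hν' r).pow 2)).congr_deriv ?_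
  rw [logS']
  push_cast
  ring

lemma hasDerivAt_logS' (hν : ν.re = 0) (r : ℝ) : HasDerivAt (logS' ν) (logS'' ν r) r := by
  have hν' : (-ν).re = 0 := by simp [hν]
  refine ((((hasDerivAt_logJ hν r).mul (hasDerivAt_logJ' hν r)).sub
    ((hasDerivAt_logJ hν' r).mul (hasDerivAt_logJ' hν' r))).const_mul 2).congr_deriv ?_
  rw [logS'', logS]
  ring

lemma hasDerivAt_logS'' (hν : ν.re = 0) (r : ℝ) : HasDerivAt (logS'' ν)
    (4 * ν ^ 2 * logS' ν r - 16 * Complex.exp (2 * r) * (logS' ν r + logS ν r)) r := by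
  have hν' : (-ν).re = 0 := by simp [hν]
  refine ((((hasDerivAt_logJ' hν r).pow 2).sub ((hasDerivAt_logJ' hν' r).pow 2)).const_mul 2
    |>.add (((((hasDerivAt_cexp_mul 2 r).const_mul 4).const_sub (ν ^ 2)).const_mul 2).mul
    (hasDerivAt_logS hν r))).congr_deriv ?_
  rw [logS', logS]
  push_cast
  ring

lemma tendsto_logS_logZ_sub (hν : ν.re = 0) (a b : ℂ) :
    Tendsto (fun r => a * logS ν r + b * logZ ν r - linExp ν
      (2 * b * ((Complex.Gamma (1 + ν))⁻¹ * (Complex.Gamma (1 - ν))⁻¹))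
      (-b * ((Complex.Gamma (1 + ν))⁻¹ * (gammaLog 1 (1 - ν) / Complex.Gamma (1 - ν) ^ 2) +
        (Complex.Gamma (1 - ν))⁻¹ * (gammaLog 1 (1 + ν) / Complex.Gamma (1 + ν) ^ 2)))
      (a * ((Complex.Gamma (1 + ν))⁻¹ ^ 2)) (-a * ((Complex.Gamma (1 - ν))⁻¹ ^ 2)) r)
      atBot (𝓝 0) := by
  have hν' : (-ν).re = 0 := by simp [hν]
  have hj := fastLim_serJ hν
  have hj' := fastLim_serJ hν'
  have hm := fastLim_serM hν
  have hm' := fastLim_serM hν'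
  rw [← sub_eq_add_neg] at hj' hm'
  have h := tendsto_sub_linExp (f := fun r => a * logS ν r + b * logZ ν r) hν
    ((hj.mul hj').const_mul (2 * b)) (((hj.mul hm').add (hj'.mul hm)).const_mul b)
    ((hj.mul hj).const_mul a) ((hj'.mul hj').const_mul (-a))
    fun r => by
      simp only [logS, logZ, logJ, logM]
      linear_combination (b * (2 * r * (serJ ν r * serJ (-ν) r) + serJ ν r * serM (-ν) r +
        serJ (-ν) r * serM ν r)) * cexp_mul_cexp_neg ν r
  convert h using 4 <;> ring

lemma tendsto_logS'_logZ'_sub (hν : ν.re = 0) (a b : ℂ) :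
    Tendsto (fun r => a * logS' ν r + b * logZ' ν r - linExp ν 0
      (2 * b * ((Complex.Gamma (1 + ν))⁻¹ * (Complex.Gamma (1 - ν))⁻¹))
      (2 * ν * a * ((Complex.Gamma (1 + ν))⁻¹ ^ 2))
      (2 * ν * a * ((Complex.Gamma (1 - ν))⁻¹ ^ 2)) r) atBot (𝓝 0) := by
  have hν' : (-ν).re = 0 := by simp [hν]
  have hj := fastLim_serJ hν
  have hj' := fastLim_serJ hν'
  have hm := fastLim_serM hν
  have hm' := fastLim_serM hν'
  have hp := fastLim_serJ' hν
  have hp' := fastLim_serJ' hν'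
  have hn := fastLim_serM' hν
  have hn' := fastLim_serM' hν'
  rw [← sub_eq_add_neg] at hj' hm'
  have h := tendsto_sub_linExp (f := fun r => a * logS' ν r + b * logZ' ν r) hν
    (((hp.mul hj').add (hj.mul hp')).const_mul (2 * b))
    ((((((hp.mul hm').add (hj.mul hn')).add (hp'.mul hm)).add (hj'.mul hn)).add
      ((hj.mul hj').const_mul 2)).const_mul b)
    ((hj.mul ((hj.const_mul ν).add hp)).const_mul (2 * a))
    ((hj'.mul ((hj'.const_mul (-ν)).add hp')).const_mul (-(2 * a)))
    fun r => by
      simp only [logS', logZ', logJ, logJ', logM, logM']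
      linear_combination (b * (2 * r * (serJ' ν r * serJ (-ν) r + serJ ν r * serJ' (-ν) r) +
        (serJ' ν r * serM (-ν) r + serJ ν r * serM' (-ν) r + serJ' (-ν) r * serM ν r +
        serJ (-ν) r * serM' ν r + 2 * (serJ ν r * serJ (-ν) r)))) * cexp_mul_cexp_neg ν r
  convert h using 4 <;> ring

lemma tendsto_logS''_logZ''_sub (hν : ν.re = 0) (a b : ℂ) :
    Tendsto (fun r => a * logS'' ν r + b * logZ'' ν r - linExp ν 0 0
      (4 * ν ^ 2 * a * ((Complex.Gamma (1 + ν))⁻¹ ^ 2))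
      (-(4 * ν ^ 2) * a * ((Complex.Gamma (1 - ν))⁻¹ ^ 2)) r) atBot (𝓝 0) := by
  have hν' : (-ν).re = 0 := by simp [hν]
  have hj := fastLim_serJ hν
  have hj' := fastLim_serJ hν'
  have hm := fastLim_serM hν
  have hm' := fastLim_serM hν'
  have hq := (FastLim.const (ν ^ 2)).sub (FastLim.exp_two.const_mul 4)
  have ht := (hj.const_mul ν).add (fastLim_serJ' hν)
  have ht' := (hj'.const_mul (-ν)).add (fastLim_serJ' hν')
  have hv := ((hm.const_mul ν).add hj).add (fastLim_serM' hν)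
  have hv' := ((hm'.const_mul (-ν)).add hj').add (fastLim_serM' hν')
  rw [← sub_eq_add_neg] at hj' hm' ht' hv'
  have h := tendsto_sub_linExp (f := fun r => a * logS'' ν r + b * logZ'' ν r) hν
    (((hq.mul (hj.mul hj')).add (ht.mul ht')).const_mul (4 * b))
    ((((hq.mul ((hj.mul hm').add (hj'.mul hm)))).add
      ((ht.mul hv').add (ht'.mul hv))).const_mul (2 * b))
    (((ht.mul ht).add (hq.mul (hj.mul hj))).const_mul (2 * a))
    (((ht'.mul ht').add (hq.mul (hj'.mul hj'))).const_mul (-(2 * a)))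
    fun r => by
      simp only [logS'', logZ'', logS, logZ, logJ, logJ', logM, logM']
      linear_combination (4 * b * r * ((ν ^ 2 - 4 * Complex.exp (2 * r)) *
        (serJ ν r * serJ (-ν) r) + (ν * serJ ν r + serJ' ν r) *
        (-ν * serJ (-ν) r + serJ' (-ν) r)) + 2 * b * ((ν ^ 2 - 4 * Complex.exp (2 * r)) *
        (serJ ν r * serM (-ν) r + serJ (-ν) r * serM ν r) + ((ν * serJ ν r + serJ' ν r) *
        (-ν * serM (-ν) r + serJ (-ν) r + serM' (-ν) r) + (-ν * serJ (-ν) r + serJ' (-ν) r) *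
        (ν * serM ν r + serJ ν r + serM' ν r)))) * cexp_mul_cexp_neg ν r
  convert h using 4 <;> ring

end

/-! ### Comparison of the two sides -/

section

variable {ν : ℂ}

lemma tendsto_neg_two_mul_smooth_sub (hν : ν.re = 0) {f R : ℝ → ℂ} {α c β γ α' c' β' γ' : ℂ}
    (hf : Continuous f) (hT : Tendsto f atTop (𝓝 0))
    (hB : Tendsto (fun s => f s - linExp ν α c β γ s) atBot (𝓝 0))
    (hR : Tendsto (fun s => R s - linExp ν α' c' β' γ' s) atBot (𝓝 0))
    (hα : α' = -2 * α) (hc : c' = -2 * c)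
    (hβ : β' = -2 * (Complex.Gamma (1 + ν) * Complex.Gamma (1 - ν)) * β)
    (hγ : γ' = -2 * (Complex.Gamma (1 + ν) * Complex.Gamma (1 - ν)) * γ) :
    Tendsto (fun r => -2 * smooth f r - R r) atBot (𝓝 0) := by
  have h := ((tendsto_smooth_sub hν hf hT hB).const_mul (-2)).sub hR
  simp only [mul_zero, sub_zero] at h
  refine h.congr fun r => ?_
  rw [smooth_linExp hν, linExp, hα, hc, hβ, hγ]
  ring

lemma macF_eq_logS_logZ (hν : ν.re = 0) (h0 : ν ≠ 0) (r : ℝ) : macF ν r =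
    -(Complex.Gamma (1 + ν) * Complex.Gamma (1 - ν)) ^ 3 / (4 * ν ^ 3) * logS ν r +
      (Complex.Gamma (1 + ν) * Complex.Gamma (1 - ν)) ^ 2 / (2 * ν ^ 2) * logZ ν r := by
  have hg : Complex.Gamma (1 + ν) ≠ 0 := Gamma_ne_zero_of_re_eq_one (by simp [hν])
  have hg' : Complex.Gamma (1 - ν) ≠ 0 := Gamma_ne_zero_of_re_eq_one (by simp [hν])
  set g := Complex.Gamma (1 + ν) with hgd
  set g' := Complex.Gamma (1 - ν) with hgd'
  set a := -(g * g') ^ 3 / (4 * ν ^ 3) with ha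
  set b := (g * g') ^ 2 / (2 * ν ^ 2) with hb
  have hu := superDecay_macK_sq hν
  have hcu := (continuous_macK hν h0).pow 2
  refine sub_eq_zero.1 (third_order_eq_zero hν h0
    (d := fun r => macF ν r - (a * logS ν r + b * logZ ν r))
    (d1 := fun r => -2 * smooth (fun s => macK ν s ^ 2) r - (a * logS' ν r + b * logZ' ν r))
    (d2 := fun r => -2 * smooth (macSq' ν) r - (a * logS'' ν r + b * logZ'' ν r))
    (fun r => ?_) (fun r => ?_) (fun r => ?_) ?_ ?_ ?_ r)
  · exact (hasDerivAt_macF hν h0 r).sub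
      (((hasDerivAt_logS hν r).const_mul a).add ((hasDerivAt_logZ hν r).const_mul b))
  · exact ((hasDerivAt_smooth_macK_sq hν h0 r).const_mul (-2)).sub
      (((hasDerivAt_logS' hν r).const_mul a).add ((hasDerivAt_logZ' hν r).const_mul b))
  · refine (((hasDerivAt_smooth_macSq' hν h0 r).const_mul (-2)).sub
      (((hasDerivAt_logS'' hν r).const_mul a).add
        ((hasDerivAt_logZ'' hν r).const_mul b))).congr_deriv ?_
    have hk : b * (8 * ν ^ 2 * (g⁻¹ * g'⁻¹)) = 4 * (g * g') := by
      rw [hb]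
      field_simp
      norm_num
    rw [smooth_macV hν h0, ← hgd, ← hgd']
    linear_combination hk
  · refine tendsto_neg_two_mul_smooth_sub hν (continuous_macU hν h0) (tendsto_macU_atTop hν)
      (tendsto_macU_sub hν) (tendsto_logS_logZ_sub hν a b) ?_ ?_ ?_ ?_ <;>
    · rw [← hgd, ← hgd']
      simp only [ha, hb]
      field_simp
      try ring
  · refine tendsto_neg_two_mul_smooth_sub hν hcu hu.tendsto
      (tendsto_macK_sq_sub hν) (tendsto_logS'_logZ'_sub hν a b) (by simp) ?_ ?_ ?_ <;>
    · rw [← hgd, ← hgd']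
      simp only [ha, hb]
      field_simp
      try ring
  · refine tendsto_neg_two_mul_smooth_sub hν (continuous_macSq' hν h0)
      (superDecay_macSq' hν).tendsto
      (tendsto_macSq'_sub hν) (tendsto_logS''_logZ''_sub hν a b) (by simp) (by simp) ?_ ?_ <;>
    · rw [← hgd, ← hgd']
      simp only [ha]
      field_simp
      try ring

lemma besselJ_eq_logJ (ν : ℂ) (r : ℝ) : besselJ ν ((2 * Real.exp r : ℝ) : ℂ) = logJ ν r :=
  besselJ_eq_expSeries ν r

lemma hasDerivAt_besselJ_order (hν : ν.re = 0) (r : ℝ) :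
    HasDerivAt (fun ε : ℝ => besselJ (ε + ν) ((2 * Real.exp r : ℝ) : ℂ)) (logM ν r) 0 := by
  have h1 : HasDerivAt (fun μ : ℂ => Complex.exp (μ * r)) (Complex.exp (ν * r) * (1 * r)) ν :=
    ((hasDerivAt_id ν).mul_const (r : ℂ)).cexp
  have h2 := h1.mul (hasDerivAt_expSeries_order norm_neg_one_le hν r)
  have h3 : HasDerivAt (fun μ => besselJ μ ((2 * Real.exp r : ℝ) : ℂ)) (logM ν r) (0 + ν) := by
    rw [zero_add]
    refine (h2.congr_deriv ?_).congr_of_eventuallyEq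
      (.of_forall fun μ => besselJ_eq_expSeries μ r)
    rw [logM, serJ, serM]
    ring
  have h4 : HasDerivAt (fun μ => besselJ (μ + ν) ((2 * Real.exp r : ℝ) : ℂ)) (logM ν r)
      ((0 : ℝ) : ℂ) := by
    rw [Complex.ofReal_zero]
    exact h3.comp_add_const 0 ν
  exact h4.comp_ofReal

lemma conj_logJ (ν : ℂ) (r : ℝ) :
    (starRingEnd ℂ) (logJ ν r) = logJ ((starRingEnd ℂ) ν) r := by
  rw [logJ, logJ, map_mul, ← Complex.exp_conj, serJ, serJ, expSeries, expSeries, Complex.conj_tsum]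
  congr 1
  · simp
  · congr 1 with k
    simp [besselCoeff, ← Complex.exp_conj, ← Complex.Gamma_conj, Complex.conj_ofNat]

lemma integral_macK_sq (hν : ν.re = 0) (h0 : ν ≠ 0) (hs : Complex.sin (π * ν) ≠ 0) (r : ℝ) :
    ∫ y in Ioi (0 : ℝ), besselK ν (Real.sqrt y : ℂ) ^ 2 /
      (((4 * Real.exp (2 * r) : ℝ) : ℂ) + (y : ℂ)) = macF ν r := by
  have hd : ∀ s : ℝ, HasDerivAt (fun s => 4 * Real.exp (2 * s)) (8 * Real.exp (2 * s)) s :=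
    fun s => (((hasDerivAt_id s).const_mul 2).exp.const_mul 4).congr_deriv (by simp; ring)
  have hi : Function.Injective fun s : ℝ => 4 * Real.exp (2 * s) := fun s t h => by
    have := Real.exp_injective (mul_left_cancel₀ (by norm_num) h)
    linarith
  have him : (fun s : ℝ => 4 * Real.exp (2 * s)) '' univ = Ioi 0 := by
    ext y
    simp only [image_univ, mem_range, mem_Ioi]
    refine ⟨fun ⟨s, h⟩ => h ▸ by positivity, fun h => ⟨Real.log (y / 4) / 2, ?_⟩⟩
    rw [mul_div_cancel₀ _ (by norm_num), Real.exp_log (by positivity)]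
    ring
  rw [← him, integral_image_eq_integral_abs_deriv_smul MeasurableSet.univ
    (fun s _ => (hd s).hasDerivWithinAt) hi.injOn, setIntegral_univ, macF_eq_stieltjes hν h0,
    stieltjes, ← integral_const_mul]
  congr 1 with s
  have hsq : Real.sqrt (4 * Real.exp (2 * s)) = 2 * Real.exp s := by
    rw [show 4 * Real.exp (2 * s) = (2 * Real.exp s) ^ 2 by
      rw [mul_pow, ← Real.exp_nat_mul]; norm_num]
    exact Real.sqrt_sq (by positivity)
  have hsig : Real.sigmoid (2 * (s - r)) =
      Real.exp (2 * s) / (Real.exp (2 * r) + Real.exp (2 * s)) := by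
    rw [Real.sigmoid_def, show -(2 * (s - r)) = 2 * r - 2 * s by ring, Real.exp_sub]
    field_simp
    ring
  have hne : ((Real.exp (2 * r) : ℝ) : ℂ) + ((Real.exp (2 * s) : ℝ) : ℂ) ≠ 0 := by
    exact_mod_cast (by positivity : Real.exp (2 * r) + Real.exp (2 * s) ≠ 0)
  rw [hsq, besselK_eq_macK hν h0 hs, abs_of_pos (by positivity), hsig, Complex.real_smul]
  simp only [Complex.ofReal_mul, Complex.ofReal_div, Complex.ofReal_add, Complex.ofReal_ofNat]
  generalize ((Real.exp (2 * r) : ℝ) : ℂ) = A, ((Real.exp (2 * s) : ℝ) : ℂ) = B at *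
  rw [← mul_add]
  field_simp
  ring

end

/-- For every `x > 0` and real `τ ≠ 0`,
`∫_0^∞ K_{iτ}(√y)²/(x+y) dy = (π³/(2 sinh²(πτ))) · [Im[J_{iτ}(√x)²]/sinh(πτ)
− (1/π)(J_{iτ}(√x)·∂_ε J_{ε−iτ}(√x)|_{ε=0} + J_{−iτ}(√x)·∂_ε J_{ε+iτ}(√x)|_{ε=0})]`. -/
theorem macdonald_square_integral (x τ : ℝ) (hx : 0 < x) (hτ : τ ≠ 0) :
    (∫ y in Set.Ioi (0 : ℝ),
        (besselK (Complex.I * τ) (Real.sqrt y : ℂ)) ^ 2 / ((x : ℂ) + (y : ℂ))) =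
      ((π ^ 3 / (2 * Real.sinh (π * τ) ^ 2) : ℝ) : ℂ) * invBracket x τ := by
  have hν : (Complex.I * τ).re = 0 := by simp
  have h0 : Complex.I * τ ≠ 0 := by simpa using hτ
  have hsh : Real.sinh (π * τ) ≠ 0 := by simp [Real.pi_ne_zero, hτ]
  have hsin : Complex.sin (π * (Complex.I * τ)) = Real.sinh (π * τ) * Complex.I := by
    rw [show (π : ℂ) * (Complex.I * τ) = ((π * τ : ℝ) : ℂ) * Complex.I by push_cast; ring,
      Complex.sin_mul_I, Complex.ofReal_sinh]
  have hs : Complex.sin (π * (Complex.I * τ)) ≠ 0 := by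
    rw [hsin]
    exact mul_ne_zero (by exact_mod_cast hsh) Complex.I_ne_zero
  obtain ⟨r, rfl⟩ : ∃ r, x = 4 * Real.exp (2 * r) := ⟨Real.log (x / 4) / 2, by
    rw [mul_div_cancel₀ _ (by norm_num), Real.exp_log (by positivity)]; ring⟩
  have hsq : Real.sqrt (4 * Real.exp (2 * r)) = 2 * Real.exp r := by
    rw [show 4 * Real.exp (2 * r) = (2 * Real.exp r) ^ 2 by
      rw [mul_pow, ← Real.exp_nat_mul]; norm_num]
    exact Real.sqrt_sq (by positivity)
  have hG := Gamma_mul_Gamma_eq h0 hs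
  have hconj : (starRingEnd ℂ) (logJ (Complex.I * τ) r) = logJ (-(Complex.I * τ)) r := by
    rw [conj_logJ]; simp
  have him : (((logJ (Complex.I * τ) r ^ 2).im : ℝ) : ℂ) =
      -(Complex.I / 2) * logS (Complex.I * τ) r := by
    rw [Complex.im_eq_sub_conj, map_pow, hconj, logS]
    have := Complex.I_sq
    field_simp
    linear_combination (logJ (Complex.I * τ) r ^ 2 - logJ (-(Complex.I * τ)) r ^ 2) * this
  have hd := (hasDerivAt_besselJ_order (ν := -(Complex.I * τ)) (by simp) r).deriv
  simp only [← sub_eq_add_neg] at hd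
  rw [integral_macK_sq hν h0 hs, macF_eq_logS_logZ hν h0, invBracket, hsq, hd,
    (hasDerivAt_besselJ_order hν r).deriv, besselJ_eq_logJ, besselJ_eq_logJ]
  rw [hsin] at hG
  have hsh' : ((Real.sinh (π * τ) : ℝ) : ℂ) ≠ 0 := by exact_mod_cast hsh
  have hτ' : (τ : ℂ) ≠ 0 := by exact_mod_cast hτ
  have hI := Complex.I_sq
  obtain hG : Complex.Gamma (1 + Complex.I * τ) * Complex.Gamma (1 - Complex.I * τ) =
      π * τ / (Real.sinh (π * τ) : ℝ) := by
    rw [eq_div_iff hsh']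
    exact mul_right_cancel₀ Complex.I_ne_zero (by linear_combination hG)
  have hpi : (π : ℂ) ≠ 0 := by exact_mod_cast Real.pi_ne_zero
  rw [hG, ← logZ]
  simp only [Complex.ofReal_div, him, Complex.ofReal_mul, Complex.ofReal_pow, Complex.ofReal_ofNat]
  have hI3 : Complex.I ^ 3 = -Complex.I := by rw [pow_succ, hI]; ring
  rw [mul_pow, mul_pow, hI, hI3]
  generalize logS (Complex.I * τ) r = S, logZ (Complex.I * τ) r = Z, ((Real.sinh (π * τ) : ℝ) : ℂ) = s at *
  field_simp
  linear_combination 4 * π * S * hI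
end

section
/- For all x > 0 and real τ, one has |J_{iτ}(√x)| ≤ √π / |Γ(iτ + 1/2)|, and consequently |Re[J_{iτ}(√x)²]| / cosh(πτ) ≤ 1. -/
open Complex Real

open MeasureTheory in
/-- Poisson's integral representation, after the substitution `s = t ^ 2`. -/
theorem besselJ_eq_integral {ν z : ℂ} (hν : -1 / 2 < ν.re) (hz : z ≠ 0) :
    besselJ ν z = (z / 2) ^ ν / ((Real.sqrt π : ℂ) * Complex.Gamma (ν + 1 / 2)) *
      ∫ s : ℝ in (0)..1, Complex.cos (z * (Real.sqrt s : ℂ)) *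
        ((s : ℂ) ^ ((1 / 2 : ℂ) - 1) * (1 - (s : ℂ)) ^ (ν + 1 / 2 - 1)) := by
  have hv : 0 < (ν + 1 / 2).re := by
    simp only [add_re, one_div, inv_re, re_ofNat, normSq_ofNat]; linarith
  have hu : 0 < (1 / 2 : ℂ).re := by norm_num
  set g : ℝ → ℂ := fun s => (s : ℂ) ^ ((1 / 2 : ℂ) - 1) * (1 - (s : ℂ)) ^ (ν + 1 / 2 - 1) with hg
  have hgi : IntervalIntegrable g volume 0 1 := betaIntegral_convergent hu hv
  set c : ℕ → ℂ := fun k => (-1) ^ k * z ^ (2 * k) / ((2 * k).factorial : ℂ) with hc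
  have hcs : Summable fun k => ‖c k‖ := (Complex.hasSum_cos z).summable.norm
  have hsum : HasSum (fun k => ∫ s : ℝ in (0)..1, c k * (s : ℂ) ^ k * g s)
      (∫ s : ℝ in (0)..1, Complex.cos (z * (Real.sqrt s : ℂ)) * g s) := by
    refine intervalIntegral.hasSum_integral_of_dominated_convergence
      (fun k s => ‖c k‖ * ‖g s‖) (fun k => ?_) (fun k => ?_) ?_ ?_ ?_
    · have : Continuous fun s : ℝ => c k * (s : ℂ) ^ k := by fun_prop
      exact this.aestronglyMeasurable.mul (by
        simpa using hgi.aestronglyMeasurable_restrict_uIoc)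
    · refine ae_of_all _ fun s hs => ?_
      rw [Set.uIoc_of_le zero_le_one] at hs
      rw [norm_mul, norm_mul, norm_pow, Complex.norm_real, Real.norm_of_nonneg hs.1.le]
      gcongr
      exact mul_le_of_le_one_right (norm_nonneg _) (pow_le_one₀ hs.1.le hs.2)
    · exact ae_of_all _ fun s _ => hcs.mul_right _
    · simp_rw [tsum_mul_right]
      exact hgi.norm.const_mul _
    · refine ae_of_all _ fun s hs => ?_
      rw [Set.uIoc_of_le zero_le_one] at hs
      refine HasSum.mul_right _ ?_
      refine (Complex.hasSum_cos (z * (Real.sqrt s : ℂ))).congr_fun fun k => ?_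
      rw [mul_pow, pow_mul (Real.sqrt s : ℂ), ← Complex.ofReal_pow (Real.sqrt s),
        Real.sq_sqrt hs.1.le]
      simp only [hc]
      ring
  have hterm (k : ℕ) : ((-1 : ℂ) ^ k * (z / 2) ^ (2 * (k : ℂ) + ν)) /
      ((k.factorial : ℂ) * Complex.Gamma ((k : ℂ) + ν + 1)) =
      (z / 2) ^ ν / ((Real.sqrt π : ℂ) * Complex.Gamma (ν + 1 / 2)) *
        ∫ s : ℝ in (0)..1, c k * (s : ℂ) ^ k * g s := by
    have hk : 0 < ((k : ℂ) + 1 / 2).re := by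
      simp only [add_re, natCast_re, one_div, inv_re, re_ofNat, normSq_ofNat]; positivity
    have hint : ∫ s : ℝ in (0)..1, c k * (s : ℂ) ^ k * g s =
        c k * betaIntegral (k + 1 / 2) (ν + 1 / 2) := by
      rw [betaIntegral, ← intervalIntegral.integral_const_mul]
      refine intervalIntegral.integral_congr_ae (ae_of_all _ fun s hs => ?_)
      rw [Set.uIoc_of_le zero_le_one] at hs
      have hs0 : (s : ℂ) ≠ 0 := Complex.ofReal_ne_zero.mpr hs.1.ne'
      rw [add_sub_assoc, Complex.cpow_add _ _ hs0, Complex.cpow_natCast]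
      simp only [hg]
      ring
    have hdup := Complex.Gamma_mul_Gamma_add_half ((k : ℂ) + 1 / 2)
    have e1 : (k : ℂ) + 1 / 2 + 1 / 2 = k + 1 := by ring
    have e2 : 2 * ((k : ℂ) + 1 / 2) = ((2 * k : ℕ) : ℂ) + 1 := by push_cast; ring
    have e3 : (1 : ℂ) - (((2 * k : ℕ) : ℂ) + 1) = -((2 * k : ℕ) : ℂ) := by ring
    rw [e1, e2, e3, Complex.Gamma_nat_eq_factorial, Complex.Gamma_nat_eq_factorial,
      Complex.cpow_neg, Complex.cpow_natCast] at hdup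
    have e4 : (k : ℂ) + 1 / 2 + (ν + 1 / 2) = k + ν + 1 := by ring
    have hG : Complex.Gamma (ν + 1 / 2) ≠ 0 := Complex.Gamma_ne_zero_of_re_pos hv
    have hGk : Complex.Gamma ((k : ℂ) + ν + 1) ≠ 0 := by
      rw [← e4]
      exact Complex.Gamma_ne_zero_of_re_pos (by rw [add_re]; exact add_pos hk hv)
    have hπ : (Real.sqrt π : ℂ) ≠ 0 :=
      Complex.ofReal_ne_zero.mpr (Real.sqrt_pos.mpr Real.pi_pos).ne'
    have hf : (k.factorial : ℂ) ≠ 0 := Nat.cast_ne_zero.mpr k.factorial_ne_zero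
    have hf2 : ((2 * k).factorial : ℂ) ≠ 0 := Nat.cast_ne_zero.mpr (2 * k).factorial_ne_zero
    have hGamma : Complex.Gamma ((k : ℂ) + 1 / 2) =
        ((2 * k).factorial : ℂ) * ((2 : ℂ) ^ (2 * k))⁻¹ * (Real.sqrt π : ℂ) / k.factorial := by
      rw [eq_div_iff hf, hdup]
    have hpow : (z / 2) ^ (2 * (k : ℂ) + ν) = z ^ (2 * k) / 2 ^ (2 * k) * (z / 2) ^ ν := by
      rw [Complex.cpow_add _ _ (div_ne_zero hz two_ne_zero), ← div_pow, ← Complex.cpow_natCast]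
      push_cast
      rfl
    rw [hint, betaIntegral_eq_Gamma_mul_div _ _ hk hv, e4, hGamma, hpow]
    simp only [hc]
    generalize Complex.Gamma (ν + 1 / 2) = G at hG ⊢
    field_simp
  rw [besselJ, tsum_congr hterm, tsum_mul_left, hsum.tsum_eq]

/-- The arcsine density integrates to `π`. -/
theorem integral_rpow_neg_half_mul_one_sub_rpow_neg_half :
    ∫ s : ℝ in (0)..1, s ^ (-1 / 2 : ℝ) * (1 - s) ^ (-1 / 2 : ℝ) = π := by
  have h := betaIntegral_eq_Gamma_mul_div (1 / 2) (1 / 2) (by norm_num) (by norm_num)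
  have hππ : (π : ℂ) ^ (1 / 2 : ℂ) * (π : ℂ) ^ (1 / 2 : ℂ) = π := by
    rw [← Complex.cpow_add _ _ (Complex.ofReal_ne_zero.mpr Real.pi_ne_zero)]
    norm_num
  rw [Complex.Gamma_one_half_eq, add_halves, Complex.Gamma_one, div_one, hππ, betaIntegral] at h
  rw [← Complex.ofReal_inj, ← h, ← intervalIntegral.integral_ofReal]
  refine intervalIntegral.integral_congr fun s hs => ?_
  rw [Set.uIcc_of_le zero_le_one] at hs
  simp only [Complex.ofReal_mul, Complex.ofReal_cpow hs.1,
    Complex.ofReal_cpow (sub_nonneg.mpr hs.2)]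
  push_cast
  norm_num

/-- Bessel functions of purely imaginary order are bounded on the positive reals. -/
theorem norm_besselJ_I_mul_le {y : ℝ} (hy : 0 < y) (τ : ℝ) :
    ‖besselJ (Complex.I * τ) (y : ℂ)‖ ≤
      Real.sqrt π / ‖Complex.Gamma (Complex.I * τ + 1 / 2)‖ := by
  rw [besselJ_eq_integral (by norm_num) (Complex.ofReal_ne_zero.mpr hy.ne'), norm_mul, norm_div,
    norm_mul, Complex.norm_real, Real.norm_of_nonneg (Real.sqrt_nonneg π)]
  have h1 : ‖((y : ℂ) / 2) ^ (Complex.I * τ)‖ = 1 := by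
    rw [show (y : ℂ) / 2 = ((y / 2 : ℝ) : ℂ) by push_cast; rfl,
      Complex.norm_cpow_eq_rpow_re_of_pos (half_pos hy)]
    simp
  have h2 : ‖∫ s : ℝ in (0)..1, Complex.cos (y * (Real.sqrt s : ℂ)) *
      ((s : ℂ) ^ ((1 / 2 : ℂ) - 1) * (1 - (s : ℂ)) ^ (Complex.I * τ + 1 / 2 - 1))‖ ≤ π := by
    conv_rhs => rw [← integral_rpow_neg_half_mul_one_sub_rpow_neg_half]
    refine intervalIntegral.norm_integral_le_of_norm_le zero_le_one ?_ ?_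
    · filter_upwards [MeasureTheory.Measure.ae_ne MeasureTheory.volume (1 : ℝ)] with s hs1 hs
      have hs' : 0 < 1 - s := sub_pos.mpr (lt_of_le_of_ne hs.2 hs1)
      rw [norm_mul, norm_mul, Complex.norm_cpow_eq_rpow_re_of_pos hs.1,
        show (1 : ℂ) - s = ((1 - s : ℝ) : ℂ) by push_cast; rfl,
        Complex.norm_cpow_eq_rpow_re_of_pos hs', ← Complex.ofReal_mul, ← Complex.ofReal_cos,
        Complex.norm_real, Real.norm_eq_abs]
      have e1 : ((1 / 2 : ℂ) - 1).re = -1 / 2 := by norm_num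
      have e2 : (Complex.I * τ + 1 / 2 - 1).re = -1 / 2 := by norm_num
      rw [e1, e2]
      exact mul_le_of_le_one_left (by have := hs.1; positivity) (Real.abs_cos_le_one _)
    · by_contra hn
      have := integral_rpow_neg_half_mul_one_sub_rpow_neg_half
      rw [intervalIntegral.integral_undef hn] at this
      exact Real.pi_ne_zero this.symm
  rw [h1]
  calc _ ≤ 1 / (Real.sqrt π * ‖Complex.Gamma (Complex.I * τ + 1 / 2)‖) * π := by gcongr
    _ = Real.sqrt π / ‖Complex.Gamma (Complex.I * τ + 1 / 2)‖ := by
      have hπ : Real.sqrt π ≠ 0 := (Real.sqrt_pos.mpr Real.pi_pos).ne'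
      conv_lhs => rw [← Real.mul_self_sqrt Real.pi_pos.le]
      rw [Real.sqrt_mul_self (Real.sqrt_nonneg π)]
      field_simp

/-- The modulus of `Γ` on the critical line `Re s = 1 / 2`. -/
theorem norm_Gamma_I_mul_add_half_sq (τ : ℝ) :
    ‖Complex.Gamma (Complex.I * τ + 1 / 2)‖ ^ 2 = π / Real.cosh (π * τ) := by
  have hconj : (1 : ℂ) - (Complex.I * τ + 1 / 2) =
      (starRingEnd ℂ) (Complex.I * τ + 1 / 2) := by
    simp only [map_add, map_mul, Complex.conj_I, Complex.conj_ofReal, map_div₀, map_one,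
      map_ofNat]
    ring
  have h := Complex.Gamma_mul_Gamma_one_sub (Complex.I * τ + 1 / 2)
  rw [hconj, Complex.Gamma_conj, Complex.mul_conj',
    show (π : ℂ) * (Complex.I * τ + 1 / 2) = (π * τ : ℂ) * Complex.I + π / 2 by ring,
    Complex.sin_add_pi_div_two, Complex.cos_mul_I] at h
  exact_mod_cast h

/-- For all `x > 0` and real `τ`: `|J_{iτ}(√x)| ≤ √π / |Γ(iτ + 1/2)|`, and consequently
`|Re[J_{iτ}(√x)²]| / cosh(πτ) ≤ 1`. -/
theorem besselJ_poisson_bound (x τ : ℝ) (hx : 0 < x) :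
    ‖besselJ (Complex.I * τ) (Real.sqrt x : ℂ)‖ ≤
        Real.sqrt π / ‖Complex.Gamma (Complex.I * τ + 1 / 2)‖ ∧
      |(((besselJ (Complex.I * τ) (Real.sqrt x : ℂ)) ^ 2).re)| / Real.cosh (π * τ) ≤ 1 := by
  have hJ := norm_besselJ_I_mul_le (Real.sqrt_pos.mpr hx) τ
  refine ⟨hJ, (div_le_one (Real.cosh_pos _)).mpr ?_⟩
  calc _ ≤ ‖besselJ (Complex.I * τ) (Real.sqrt x : ℂ) ^ 2‖ := Complex.abs_re_le_norm _
    _ = ‖besselJ (Complex.I * τ) (Real.sqrt x : ℂ)‖ ^ 2 := norm_pow _ _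
    _ ≤ (Real.sqrt π / ‖Complex.Gamma (Complex.I * τ + 1 / 2)‖) ^ 2 := by gcongr
    _ = Real.cosh (π * τ) := by
      rw [div_pow, Real.sq_sqrt Real.pi_pos.le, norm_Gamma_I_mul_add_half_sq,
        div_div_cancel₀ Real.pi_ne_zero]
end
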